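/- arXiv:1001.0023 — 4 statements merged into one kernel-verified Lean document; each statement's English description precedes it below -/
import Mathlib

section
/- Let X ⊆ ℝ^m and Y ⊆ ℝ^n be closed subsets. In the ring C∞(ℝ^{m+n}), the ideal generated by the set {g ∘ π₁ : g ∈ m_X^∞} ∪ {h ∘ π₂ : h ∈ m_Y^∞}, where π₁ : ℝ^{m+n} → ℝ^m and π₂ : ℝ^{m+n} → ℝ^n are the coordinate projections, is equal to m_{X×Y}^∞. -/
noncomputable section

/-- The `ℝ`-algebra `C∞(ℝ^n)` of smooth functions `ℝ^n → ℝ`. -/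
def SmoothAlg (n : ℕ) : Subalgebra ℝ ((Fin n → ℝ) → ℝ) where
  carrier := {f | ContDiff ℝ (⊤ : ℕ∞) f}
  mul_mem' := fun {f g} hf hg => by
    simp only [Set.mem_setOf_eq] at *; exact hf.mul hg
  one_mem' := by simp only [Set.mem_setOf_eq]; exact contDiff_const
  add_mem' := fun {f g} hf hg => by
    simp only [Set.mem_setOf_eq] at *; exact hf.add hg
  zero_mem' := by simp only [Set.mem_setOf_eq]; exact contDiff_const
  algebraMap_mem' := fun r => by
    simp only [Set.mem_setOf_eq]; exact contDiff_const

/-- `FlatOn n X f` says `f ∈ m_X^∞`: all iterated derivatives of `f` vanish at every point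
of `X`. -/
def FlatOn (n : ℕ) (X : Set (Fin n → ℝ)) (f : SmoothAlg n) : Prop :=
  ∀ (k : ℕ), ∀ x ∈ X, iteratedFDeriv ℝ k (f : (Fin n → ℝ) → ℝ) x = 0

section FlatIdeals

open MeasureTheory Filter Topology

/-- Derivatives of the convolution of a fixed test function with a measurable function bounded
by `1` are bounded independently of the latter. -/
lemma exists_norm_iteratedFDeriv_convolution_le {G : Type} [NormedAddCommGroup G] [NormedSpace ℝ G]
    [FiniteDimensional ℝ G] [MeasurableSpace G] [BorelSpace G] (μ : Measure G) [μ.IsAddHaarMeasure]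
    (k : ℕ) : ∀ {E F : Type} [NormedAddCommGroup E] [NormedSpace ℝ E] [NormedAddCommGroup F]
    [NormedSpace ℝ F] (L : E →L[ℝ] ℝ →L[ℝ] F) {f : G → E}, HasCompactSupport f →
    ContDiff ℝ (⊤ : ℕ∞) f → ∃ C : ℝ, ∀ g : G → ℝ, Measurable g → (∀ x, ‖g x‖ ≤ 1) →
      ∀ x, ‖iteratedFDeriv ℝ k (convolution f g L μ) x‖ ≤ C := by
  induction k with
  | zero =>
    intro E F _ _ _ _ L f hf hfc
    refine ⟨∫ t, ‖L‖ * ‖f t‖ ∂μ, fun g _ hg1 x => ?_⟩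
    rw [norm_iteratedFDeriv_zero, convolution_def]
    have hint : Integrable f μ := hfc.continuous.integrable_of_hasCompactSupport hf
    refine norm_integral_le_of_norm_le (hint.norm.const_mul _) (Eventually.of_forall fun t => ?_)
    calc ‖L (f t) (g (x - t))‖ ≤ ‖L‖ * ‖f t‖ * ‖g (x - t)‖ := L.le_opNorm₂ _ _
      _ ≤ ‖L‖ * ‖f t‖ * 1 := by gcongr; exact hg1 _
      _ = ‖L‖ * ‖f t‖ := mul_one _
  | succ k ih =>
    intro E F _ _ _ _ L f hf hfc
    obtain ⟨C, hC⟩ := ih (L.precompL G) (hf.fderiv (𝕜 := ℝ))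
      (hfc.fderiv_right (m := (⊤ : ℕ∞)) (by simp))
    refine ⟨C, fun g hg hg1 x => ?_⟩
    have hloc : LocallyIntegrable g μ :=
      (locallyIntegrable_const (1 : ℝ)).mono hg.aestronglyMeasurable
        (Eventually.of_forall fun t => by simpa using hg1 t)
    have hd : fderiv ℝ (convolution f g L μ) = convolution (fderiv ℝ f) g (L.precompL G) μ := by
      ext1 y
      exact (hf.hasFDerivAt_convolution_left L (hfc.of_le (by exact_mod_cast le_top)) hloc y).fderiv
    rw [← norm_iteratedFDeriv_fderiv, hd]
    exact hC g hg hg1 x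

/-- Smooth cutoff functions vanishing near a set `X` and equal to `1` at distance at least `r`
from `X`, with derivative bounds depending on `r` only. -/
lemma exists_cutoff (d : ℕ) : ∃ C : ℕ → ℝ, ∀ (X : Set (Fin d → ℝ)) (r : ℝ), 0 < r →
    ∃ χ : (Fin d → ℝ) → ℝ, ContDiff ℝ (⊤ : ℕ∞) χ ∧ (∀ x, 0 ≤ χ x) ∧
      (∀ x ∈ X, χ =ᶠ[𝓝 x] 0) ∧ (∀ x, (∀ w ∈ X, r ≤ dist x w) → χ x = 1) ∧
      ∀ k x, ‖iteratedFDeriv ℝ k χ x‖ ≤ C k * r⁻¹ ^ k := by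
  let φ : ContDiffBump (0 : Fin d → ℝ) := ⟨1 / 8, 1 / 4, by norm_num, by norm_num⟩
  have hφ : ContDiff ℝ (⊤ : ℕ∞) (φ.normed volume) := φ.contDiff_normed
  have hφc : HasCompactSupport (φ.normed volume) := φ.hasCompactSupport_normed
  choose C hC using fun k => exists_norm_iteratedFDeriv_convolution_le volume k
    (ContinuousLinearMap.lsmul ℝ ℝ) hφc hφ
  refine ⟨C, fun X r hr => ?_⟩
  set T := Metric.thickening (1 / 2) {y : Fin d → ℝ | r • y ∈ X} with hT
  set g : (Fin d → ℝ) → ℝ := Tᶜ.indicator fun _ => 1 with hg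
  have hgm : Measurable g :=
    measurable_const.indicator Metric.isOpen_thickening.measurableSet.compl
  have hg1 : ∀ x, ‖g x‖ ≤ 1 := fun x => by
    by_cases hx : x ∈ T <;> simp [hg, hx]
  have hg0 : ∀ x, 0 ≤ g x := fun x => by
    by_cases hx : x ∈ T <;> simp [hg, hx]
  set ψ := convolution (φ.normed volume) g (ContinuousLinearMap.lsmul ℝ ℝ) volume with hψ
  have hψs : ContDiff ℝ (⊤ : ℕ∞) ψ := hφc.contDiff_convolution_left _ hφ
    ((locallyIntegrable_const (1 : ℝ)).mono hgm.aestronglyMeasurable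
      (Eventually.of_forall fun t => by simpa using hg1 t))
  have hdist : ∀ x y : Fin d → ℝ, dist (r⁻¹ • x) (r⁻¹ • y) = r⁻¹ * dist x y := fun x y => by
    rw [dist_smul₀, Real.norm_of_nonneg (by positivity)]
  refine ⟨fun x => ψ (r⁻¹ • x), hψs.comp (contDiff_const_smul _), fun x => ?_, fun x hx => ?_,
    fun x hx => ?_, fun k x => ?_⟩
  · exact integral_nonneg fun t => mul_nonneg (φ.nonneg_normed t) (hg0 _)
  · filter_upwards [Metric.ball_mem_nhds x (show 0 < r / 8 by positivity)] with y hy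
    have key : ∀ z ∈ Metric.ball (r⁻¹ • y) (3 / 8), g z = 0 := by
      intro z hz
      have hzT : z ∈ T := by
        refine Metric.mem_thickening_iff.2 ⟨r⁻¹ • x, by simpa [smul_smul, hr.ne'] using hx, ?_⟩
        have h1 := dist_triangle z (r⁻¹ • y) (r⁻¹ • x)
        have h2 : r⁻¹ * dist y x < 1 / 8 := by
          rw [inv_mul_lt_iff₀ hr]; rw [Metric.mem_ball] at hy; linarith
        rw [Metric.mem_ball] at hz
        rw [hdist] at h1
        linarith
      simp [hg, hzT]
    have h0 := key (r⁻¹ • y) (Metric.mem_ball_self (by norm_num))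
    have := φ.normed_convolution_eq_right (μ := volume) (g := g) (x₀ := r⁻¹ • y) fun z hz => by
      rw [h0]; exact key z (Metric.ball_subset_ball (by norm_num [φ]) hz)
    simp only [Pi.zero_apply]
    rw [hψ, this, h0]
  · have key : ∀ z ∈ Metric.ball (r⁻¹ • x) (1 / 4), g z = 1 := by
      intro z hz
      have hzT : z ∉ T := by
        intro h
        obtain ⟨w, hw, hzw⟩ := Metric.mem_thickening_iff.1 h
        have h1 := dist_triangle_left (r⁻¹ • x) w z
        have h2 : 1 ≤ dist (r⁻¹ • x) w := by
          have := hdist x (r • w)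
          rw [smul_smul, inv_mul_cancel₀ hr.ne', one_smul] at this
          rw [this, ← inv_mul_cancel₀ hr.ne']
          gcongr
          exact hx _ hw
        rw [Metric.mem_ball] at hz
        linarith
      simp [hg, hzT]
    have h0 := key (r⁻¹ • x) (Metric.mem_ball_self (by norm_num))
    have := φ.normed_convolution_eq_right (μ := volume) (g := g) (x₀ := r⁻¹ • x) fun z hz => by
      rw [h0]; exact key z hz
    exact this.trans h0
  · rw [iteratedFDeriv_comp_const_smul _ (hψs.of_le (by exact_mod_cast le_top)), norm_smul,
      norm_pow, Real.norm_of_nonneg (by positivity), mul_comm]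
    gcongr
    exact hC k g hgm hg1 _

/-- A nonnegative smooth function flat on `X` and bounded below by `ε j` at distance at least
`2⁻ʲ` from `X`. -/
lemma exists_flat_ge (d : ℕ) (X : Set (Fin d → ℝ)) (ε : ℕ → ℝ) (hε : ∀ j, 0 < ε j)
    (hs : ∀ k : ℕ, Summable fun j => ε j * (2 ^ j) ^ k) :
    ∃ g : (Fin d → ℝ) → ℝ, ContDiff ℝ (⊤ : ℕ∞) g ∧ (∀ x, 0 ≤ g x) ∧
      (∀ k, ∀ x ∈ X, iteratedFDeriv ℝ k g x = 0) ∧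
      ∀ j x, (∀ w ∈ X, ((2 : ℝ) ^ j)⁻¹ ≤ dist x w) → ε j ≤ g x := by
  obtain ⟨C, hC⟩ := exists_cutoff d
  choose χ hχs hχ0 hχX hχ1 hχb using fun j : ℕ => hC X ((2 : ℝ) ^ j)⁻¹ (by positivity)
  have hF : ∀ j, ContDiff ℝ (⊤ : ℕ∞) (ε j • χ j) := fun j => contDiff_const.smul (hχs j)
  have hle : ∀ k : ℕ, ((k : ℕ∞) : WithTop ℕ∞) ≤ (⊤ : ℕ∞) := fun k => by exact_mod_cast le_top
  have hb : ∀ (k : ℕ) (j : ℕ) (x : Fin d → ℝ), (k : ℕ∞) ≤ ⊤ →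
      ‖iteratedFDeriv ℝ k (ε j • χ j) x‖ ≤ C k * (ε j * (2 ^ j) ^ k) := fun k j x _ => by
    rw [iteratedFDeriv_const_smul_apply ((hχs j).of_le (hle k)).contDiffAt, norm_smul,
      Real.norm_of_nonneg (hε j).le, mul_left_comm]
    have := hχb j k x
    rw [inv_inv] at this
    exact mul_le_mul_of_nonneg_left this (hε j).le
  have hv : ∀ k : ℕ, (k : ℕ∞) ≤ ⊤ → Summable fun j => C k * (ε j * (2 ^ j) ^ k) :=
    fun k _ => (hs k).mul_left _
  refine ⟨fun x => ∑' j, (ε j • χ j) x, contDiff_tsum hF hv hb, fun x => ?_, fun k x hx => ?_,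
    fun j x hx => ?_⟩
  · exact tsum_nonneg fun j => mul_nonneg (hε j).le (hχ0 j x)
  · rw [iteratedFDeriv_tsum_apply hF hv hb le_top]
    refine (tsum_congr fun j => ?_).trans tsum_zero
    have h : (ε j • χ j) =ᶠ[𝓝 x] 0 := by
      filter_upwards [hχX j x hx] with y hy
      simp [hy]
    rw [(h.iteratedFDeriv ℝ k).eq_of_nhds]
    simp
  · have hsum : Summable fun j => (ε j • χ j) x := by
      refine Summable.of_norm_bounded (hv 0 le_top) fun j => ?_
      simpa using hb 0 j x le_top
    have := hsum.le_tsum j fun i _ => mul_nonneg (hε i).le (hχ0 i x)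
    simpa [hχ1 j x hx] using this

/-- A diagonal choice from countably many eventually true properties. -/
lemma exists_tendsto_atTop_diagonal {P : ℕ → ℕ → Prop} (h : ∀ k, ∀ᶠ j in atTop, P k j) :
    ∃ κ : ℕ → ℕ, Tendsto κ atTop atTop ∧ ∀ᶠ j in atTop, P (κ j) j := by
  classical
  choose J hJ using fun k => eventually_atTop.1 (h k)
  refine ⟨fun j => Nat.findGreatest (fun k => J k ≤ j) j, tendsto_atTop.2 fun k => ?_, ?_⟩
  · filter_upwards [eventually_ge_atTop k, eventually_ge_atTop (J k)] with j h1 h2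
    exact Nat.le_findGreatest h1 h2
  · filter_upwards [eventually_ge_atTop (J 0)] with j h0
    exact hJ _ _ (Nat.findGreatest_spec (P := fun k => J k ≤ j) (Nat.zero_le j) h0)

/-- A smooth function flat on `Z` decays, with its derivatives, faster than any power of the
distance to `Z`, uniformly on balls. -/
lemma exists_norm_iteratedFDeriv_le_dist_pow {E : Type} [NormedAddCommGroup E] [NormedSpace ℝ E]
    [FiniteDimensional ℝ E] {f : E → ℝ} (hf : ContDiff ℝ (⊤ : ℕ∞) f) {Z : Set E}
    (hZ : ∀ k, ∀ z ∈ Z, iteratedFDeriv ℝ k f z = 0) (R : ℝ) (N : ℕ) : ∀ i : ℕ,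
    ∃ C : ℝ, 0 ≤ C ∧ ∀ z w, ‖z‖ ≤ R → w ∈ Z → ‖w‖ ≤ R →
      ‖iteratedFDeriv ℝ i f z‖ ≤ C * dist z w ^ N := by
  have := FiniteDimensional.proper ℝ E
  induction N with
  | zero =>
    intro i
    obtain ⟨C, hC⟩ := (isCompact_closedBall (0 : E) R).exists_bound_of_continuousOn
      (hf.continuous_iteratedFDeriv (m := i) (by exact_mod_cast le_top)).continuousOn
    refine ⟨max C 0, le_max_right _ _, fun z w hz _ _ => ?_⟩
    rw [pow_zero, mul_one]
    exact (hC z (by simpa using hz)).trans (le_max_left _ _)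
  | succ N ih =>
    intro i
    obtain ⟨C, hC0, hC⟩ := ih (i + 1)
    refine ⟨C, hC0, fun z w hz hw hwR => ?_⟩
    have hseg : ∀ u ∈ segment ℝ w z, ‖u‖ ≤ R ∧ dist u w ≤ dist z w := fun u hu => by
      have h1 := (convex_closedBall (0 : E) R).segment_subset (by simpa using hwR)
        (by simpa using hz) hu
      have h2 := (convex_closedBall w (dist z w)).segment_subset (by simp) (by simp) hu
      exact ⟨by simpa using h1, by simpa using h2⟩
    have := (convex_segment (𝕜 := ℝ) w z).norm_image_sub_le_of_norm_fderiv_le (𝕜 := ℝ)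
      (f := iteratedFDeriv ℝ i f) (C := C * dist z w ^ N)
      (fun u _ => hf.differentiable_iteratedFDeriv (by exact_mod_cast ENat.natCast_lt_top i) u)
      (fun u hu => by
        rw [norm_fderiv_iteratedFDeriv]
        refine (hC u w (hseg u hu).1 hw hwR).trans ?_
        gcongr
        exact (hseg u hu).2) (left_mem_segment ℝ w z) (right_mem_segment ℝ w z)
    rwa [hZ i w hw, sub_zero, ← dist_eq_norm, mul_assoc, ← pow_succ] at this

/-- There are positive, rapidly decreasing `ε j` whose powers dominate all derivatives of a
function flat on `Z` at distance comparable to `2⁻ʲ` from `Z`, locally. -/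
lemma exists_slow_rate {E : Type} [NormedAddCommGroup E] [NormedSpace ℝ E]
    [FiniteDimensional ℝ E] {f : E → ℝ} (hf : ContDiff ℝ (⊤ : ℕ∞) f) {Z : Set E}
    (hZ : ∀ k, ∀ z ∈ Z, iteratedFDeriv ℝ k f z = 0) :
    ∃ ε : ℕ → ℝ, (∀ j, 0 < ε j) ∧ (∀ k : ℕ, Summable fun j => ε j * (2 ^ j) ^ k) ∧
      ∀ k : ℕ, ∀ᶠ j in atTop, ∀ z, ‖z‖ ≤ k → ∀ w ∈ Z, dist z w ≤ 2 * ((2 : ℝ) ^ j)⁻¹ →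
        ∀ i ≤ k, ‖iteratedFDeriv ℝ i f z‖ ≤ ε j ^ k := by
  have htend : Tendsto (fun j : ℕ => ((2 : ℝ) ^ j)⁻¹) atTop (𝓝 0) :=
    tendsto_inv_atTop_zero.comp (tendsto_pow_atTop_atTop_of_one_lt one_lt_two)
  have hle1 : ∀ j : ℕ, ((2 : ℝ) ^ j)⁻¹ ≤ 1 := fun j => inv_le_one_of_one_le₀ (one_le_pow₀ one_le_two)
  have key : ∀ k : ℕ, ∀ᶠ j in atTop, ∀ i ∈ Finset.range (k + 1), ∀ z, ‖z‖ ≤ k → ∀ w ∈ Z,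
      dist z w ≤ 2 * ((2 : ℝ) ^ j)⁻¹ →
        ‖iteratedFDeriv ℝ i f z‖ ≤ (((2 : ℝ) ^ j)⁻¹) ^ (k * k) := by
    intro k
    rw [eventually_all_finset]
    intro i _
    obtain ⟨C, hC0, hC⟩ := exists_norm_iteratedFDeriv_le_dist_pow hf hZ (k + 2) (k * k + 1) i
    have h0 : Tendsto (fun j : ℕ => C * 2 ^ (k * k + 1) * ((2 : ℝ) ^ j)⁻¹) atTop (𝓝 0) := by
      simpa using htend.const_mul (C * 2 ^ (k * k + 1))
    filter_upwards [h0.eventually_le_const one_pos] with j hj z hz w hw hzw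
    have hwR : ‖w‖ ≤ k + 2 := by
      have := norm_le_norm_add_norm_sub z w
      rw [← dist_eq_norm] at this
      linarith [hle1 j]
    calc ‖iteratedFDeriv ℝ i f z‖ ≤ C * dist z w ^ (k * k + 1) :=
          hC z w (by linarith) hw hwR
      _ ≤ C * (2 * ((2 : ℝ) ^ j)⁻¹) ^ (k * k + 1) := by gcongr
      _ = (C * 2 ^ (k * k + 1) * ((2 : ℝ) ^ j)⁻¹) * (((2 : ℝ) ^ j)⁻¹) ^ (k * k) := by
          rw [mul_pow, pow_succ (((2 : ℝ) ^ j)⁻¹)]; ring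
      _ ≤ 1 * (((2 : ℝ) ^ j)⁻¹) ^ (k * k) := by gcongr
      _ = _ := one_mul _
  obtain ⟨κ, hκ, hP⟩ := exists_tendsto_atTop_diagonal key
  refine ⟨fun j => (((2 : ℝ) ^ j)⁻¹) ^ κ j, fun j => by positivity, fun k => ?_, fun k => ?_⟩
  · refine Summable.of_norm_bounded_eventually_nat summable_geometric_two ?_
    filter_upwards [hκ.eventually_ge_atTop (k + 1)] with j hj
    rw [Real.norm_of_nonneg (by positivity)]
    calc (((2 : ℝ) ^ j)⁻¹) ^ κ j * (2 ^ j) ^ k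
        ≤ (((2 : ℝ) ^ j)⁻¹) ^ (k + 1) * (2 ^ j) ^ k :=
          mul_le_mul_of_nonneg_right (pow_le_pow_of_le_one (by positivity) (hle1 j) hj)
            (by positivity)
      _ = (1 / 2) ^ j := by
          rw [pow_succ, mul_right_comm, ← mul_pow, inv_mul_cancel₀ (by positivity), one_pow,
            one_mul, one_div, inv_pow]
  · filter_upwards [hκ.eventually_ge_atTop k, hP] with j hj hPj z hz w hw hzw i hi
    refine (hPj i (by simp; omega) z (hz.trans (by exact_mod_cast hj)) w hw hzw).trans ?_
    rw [pow_mul]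
    exact pow_le_pow_of_le_one (by positivity) (pow_le_one₀ (by positivity) (hle1 j)) hj

/-- `f` is smooth and, near each zero of `φ`, all its derivatives are dominated by all powers
of `φ`. -/
def DominatedBy {E F : Type} [NormedAddCommGroup E] [NormedSpace ℝ E] [NormedAddCommGroup F]
    [NormedSpace ℝ F] (φ : E → ℝ) (f : E → F) : Prop :=
  ContDiff ℝ (⊤ : ℕ∞) f ∧ ∀ z, φ z = 0 → ∀ i N : ℕ,
    (fun y => ‖iteratedFDeriv ℝ i f y‖) =O[𝓝 z] fun y => φ y ^ N

namespace DominatedBy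

variable {E F : Type} [NormedAddCommGroup E] [NormedSpace ℝ E] [NormedAddCommGroup F]
  [NormedSpace ℝ F] {φ : E → ℝ} {f : E → F}

lemma fderiv (hf : DominatedBy φ f) : DominatedBy φ (fderiv ℝ f) := by
  refine ⟨hf.1.fderiv_right (by simp), fun z hz i N => ?_⟩
  simpa only [norm_iteratedFDeriv_fderiv] using hf.2 z hz (i + 1) N

set_option maxSynthPendingDepth 4 in
lemma smulRight_fderiv (hφ : ContDiff ℝ (⊤ : ℕ∞) φ) (hf : DominatedBy φ f) :
    DominatedBy φ fun z => (_root_.fderiv ℝ φ z).smulRight (f z) := by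
  have hφ' : ContDiff ℝ (⊤ : ℕ∞) (_root_.fderiv ℝ φ) := hφ.fderiv_right (by simp)
  let B : (E →L[ℝ] ℝ) →L[ℝ] F →L[ℝ] E →L[ℝ] F := ContinuousLinearMap.smulRightL ℝ E F
  refine ⟨(B.isBoundedBilinearMap.contDiff).comp (hφ'.prodMk hf.1), fun z hz i N => ?_⟩
  have hle := fun y => B.norm_iteratedFDeriv_le_of_bilinear hφ' hf.1 y (n := i)
    (by exact_mod_cast le_top)
  refine (Asymptotics.IsBigO.of_norm_le (g := fun y => ‖B‖ * ∑ j ∈ Finset.range (i + 1),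
    (i.choose j : ℝ) * ‖iteratedFDeriv ℝ j (_root_.fderiv ℝ φ) y‖ *
      ‖iteratedFDeriv ℝ (i - j) f y‖) fun y => ?_).trans ?_
  · rw [norm_norm]; exact hle y
  · refine Asymptotics.IsBigO.const_mul_left (Asymptotics.IsBigO.fun_sum fun j _ => ?_) _
    have h1 : (fun y => (i.choose j : ℝ) * ‖iteratedFDeriv ℝ j (_root_.fderiv ℝ φ) y‖)
        =O[𝓝 z] fun _ => (1 : ℝ) :=
      ((continuous_const.mul (hφ'.continuous_iteratedFDeriv (m := j)
        (by exact_mod_cast le_top)).norm).tendsto z).isBigO_one ℝ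
    simpa using h1.mul (hf.2 z hz (i - j) N)

lemma isBigO (hf : DominatedBy φ f) {z : E} (hz : φ z = 0) (N : ℕ) :
    f =O[𝓝 z] fun y => φ y ^ N := by
  simpa using hf.2 z hz 0 N

lemma eq_zero (hf : DominatedBy φ f) {z : E} (hz : φ z = 0) : f z = 0 := by
  have := (hf.isBigO hz 1).eq_zero_imp.self_of_nhds
  simpa [hz] using this

lemma hasFDerivAt_inv_pow_smul (hφ : ContDiff ℝ (⊤ : ℕ∞) φ) (hf : DominatedBy φ f) (N : ℕ)
    (z : E) : HasFDerivAt (fun y => (φ y ^ N)⁻¹ • f y)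
      ((φ z ^ N)⁻¹ • _root_.fderiv ℝ f z -
        (N : ℝ) • (φ z ^ (N + 1))⁻¹ • (_root_.fderiv ℝ φ z).smulRight (f z)) z := by
  have hφd := (hφ.differentiable (by simp) z).hasFDerivAt
  have hfd := (hf.1.differentiable (by simp) z).hasFDerivAt
  by_cases hz : φ z = 0
  · have h1 : _root_.fderiv ℝ f z = 0 := hf.fderiv.eq_zero hz
    rw [h1, hf.eq_zero hz, ContinuousLinearMap.smulRight_zero, smul_zero, smul_zero, smul_zero,
      sub_zero, hasFDerivAt_iff_isLittleO]
    have hq : (fun y => (φ y ^ N)⁻¹ • f y) =O[𝓝 z] fun y => φ y * φ y := by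
      refine ((Asymptotics.isBigO_refl (fun y => (φ y ^ N)⁻¹) (𝓝 z)).smul
        (hf.isBigO hz (N + 2))).trans (Asymptotics.IsBigO.of_norm_le fun y => ?_)
      by_cases hy : φ y = 0
      · simp [hy]
      · rw [smul_eq_mul, pow_add, inv_mul_cancel_left₀ (pow_ne_zero _ hy), sq,
          Real.norm_of_nonneg (mul_self_nonneg _)]
    have hO : φ =O[𝓝 z] fun y => y - z := by simpa [hz] using hφd.isBigO_sub
    have ho : φ =o[𝓝 z] fun _ => (1 : ℝ) := by
      rw [Asymptotics.isLittleO_one_iff, ← hz]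
      exact hφ.continuous.tendsto z
    have : (fun y => φ y * φ y) =o[𝓝 z] fun y => y - z := by
      simpa using ho.mul_isBigO hO.norm_right
    simpa [hf.eq_zero hz] using hq.trans_isLittleO this
  · have hinv := ((hasDerivAt_pow N (φ z)).fun_inv (pow_ne_zero _ hz)).comp_hasFDerivAt z hφd
    refine (hinv.smul hfd).congr_fderiv ?_
    ext v
    have : -(N * φ z ^ (N - 1)) / (φ z ^ N) ^ 2 = -((N : ℝ) * (φ z ^ (N + 1))⁻¹) := by
      rcases N with _ | N
      · simp
      · field_simp
        rw [add_tsub_cancel_right]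
        ring
    simp only [Function.comp_apply, add_apply, sub_apply, smul_apply,
      ContinuousLinearMap.smulRight_apply, smul_eq_mul, this]
    module

/-- Dividing by powers of `φ` preserves smoothness. -/
lemma contDiff_inv_pow_smul (hφ : ContDiff ℝ (⊤ : ℕ∞) φ) (n : ℕ) : ∀ {F : Type}
    [NormedAddCommGroup F] [NormedSpace ℝ F] {f : E → F}, DominatedBy φ f → ∀ N : ℕ,
    ContDiff ℝ n fun y => (φ y ^ N)⁻¹ • f y := by
  induction n with
  | zero =>
    intro F _ _ f hf N
    exact contDiff_zero.2 (continuous_iff_continuousAt.2 fun z =>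
      (hf.hasFDerivAt_inv_pow_smul hφ N z).continuousAt)
  | succ n ih =>
    intro F _ _ f hf N
    exact contDiff_succ_iff_hasFDerivAt.2 ⟨_, (ih hf.fderiv N).sub
      ((ih (hf.smulRight_fderiv hφ) (N + 1)).const_smul (N : ℝ)),
      hf.hasFDerivAt_inv_pow_smul hφ N⟩

end DominatedBy

/-- Smooth functions flat on `X` form an ideal. -/
def flatIdeal (d : ℕ) (X : Set (Fin d → ℝ)) : Ideal (SmoothAlg d) where
  carrier := {f | FlatOn d X f}
  zero_mem' := fun k x _ => by
    change iteratedFDeriv ℝ k (0 : (Fin d → ℝ) → ℝ) x = 0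
    simp
  add_mem' := fun {f g} hf hg k x hx => by
    change iteratedFDeriv ℝ k ((f : (Fin d → ℝ) → ℝ) + (g : (Fin d → ℝ) → ℝ)) x = 0
    have hf' : ContDiff ℝ (⊤ : ℕ∞) (f : (Fin d → ℝ) → ℝ) := f.2
    have hg' : ContDiff ℝ (⊤ : ℕ∞) (g : (Fin d → ℝ) → ℝ) := g.2
    rw [iteratedFDeriv_add_apply (hf'.of_le (by exact_mod_cast le_top)).contDiffAt
      (hg'.of_le (by exact_mod_cast le_top)).contDiffAt, hf k x hx, hg k x hx, add_zero]
  smul_mem' := fun c f hf k x hx => by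
    change iteratedFDeriv ℝ k
      (fun y => (c : (Fin d → ℝ) → ℝ) y * (f : (Fin d → ℝ) → ℝ) y) x = 0
    have hc : ContDiff ℝ (⊤ : ℕ∞) (c : (Fin d → ℝ) → ℝ) := c.2
    refine norm_le_zero_iff.1 ((norm_iteratedFDeriv_mul_le hc f.2 x (n := k)
      (by exact_mod_cast le_top)).trans_eq (Finset.sum_eq_zero fun i _ => ?_))
    rw [hf (k - i) x hx, norm_zero, mul_zero]

/-- The pullback of a flat function along a continuous linear map is flat on the preimage. -/
lemma iteratedFDeriv_comp_clm_eq_zero {E F : Type} [NormedAddCommGroup E] [NormedSpace ℝ E]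
    [NormedAddCommGroup F] [NormedSpace ℝ F] (L : E →L[ℝ] F) {g : F → ℝ}
    (hg : ContDiff ℝ (⊤ : ℕ∞) g) {k : ℕ} {x : E} (h : iteratedFDeriv ℝ k g (L x) = 0) :
    iteratedFDeriv ℝ k (fun y => g (L y)) x = 0 := by
  have := L.iteratedFDeriv_comp_right hg x (i := k) (by exact_mod_cast le_top)
  rw [h] at this
  refine this.trans ?_
  ext
  simp

/-- The projection `ℝ^{m+n} → ℝ^m`. -/
def projLeft (m n : ℕ) : (Fin (m + n) → ℝ) →L[ℝ] (Fin m → ℝ) :=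
  ContinuousLinearMap.pi fun i => ContinuousLinearMap.proj (Fin.castAdd n i)

/-- The projection `ℝ^{m+n} → ℝ^n`. -/
def projRight (m n : ℕ) : (Fin (m + n) → ℝ) →L[ℝ] (Fin n → ℝ) :=
  ContinuousLinearMap.pi fun j => ContinuousLinearMap.proj (Fin.natAdd m j)

lemma dist_projLeft_le {m n : ℕ} (x y : Fin (m + n) → ℝ) :
    dist (projLeft m n x) (projLeft m n y) ≤ dist x y :=
  (dist_pi_le_iff dist_nonneg).2 fun i => dist_le_pi_dist x y (Fin.castAdd n i)

lemma dist_projRight_le {m n : ℕ} (x y : Fin (m + n) → ℝ) :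
    dist (projRight m n x) (projRight m n y) ≤ dist x y :=
  (dist_pi_le_iff dist_nonneg).2 fun j => dist_le_pi_dist x y (Fin.natAdd m j)

lemma projLeft_append {m n : ℕ} (v : Fin m → ℝ) (w : Fin n → ℝ) :
    projLeft m n (Fin.append v w) = v :=
  funext fun i => Fin.append_left v w i

lemma projRight_append {m n : ℕ} (v : Fin m → ℝ) (w : Fin n → ℝ) :
    projRight m n (Fin.append v w) = w :=
  funext fun j => Fin.append_right v w j

lemma dist_append_le {m n : ℕ} {z : Fin (m + n) → ℝ} {v : Fin m → ℝ} {w : Fin n → ℝ} {r : ℝ}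
    (hr : 0 ≤ r) (hv : dist (projLeft m n z) v ≤ r) (hw : dist (projRight m n z) w ≤ r) :
    dist z (Fin.append v w) ≤ r := by
  refine (dist_pi_le_iff hr).2 fun i => ?_
  induction i using Fin.addCases with
  | left i =>
    rw [Fin.append_left]
    exact (dist_le_pi_dist (projLeft m n z) v i).trans hv
  | right j =>
    rw [Fin.append_right]
    exact (dist_le_pi_dist (projRight m n z) w j).trans hw

/-- A point outside a closed set has distance at least some `2⁻ʲ` from it. -/
lemma IsClosed.exists_inv_two_pow_le_dist {E : Type} [PseudoMetricSpace E] {X : Set E}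
    (hX : IsClosed X) {x : E} (hx : x ∉ X) : ∃ j : ℕ, ∀ w ∈ X, ((2 : ℝ) ^ j)⁻¹ ≤ dist x w := by
  obtain ⟨δ, hδ, hb⟩ := Metric.isOpen_iff.1 hX.isOpen_compl x hx
  obtain ⟨j, hj⟩ := exists_pow_lt_of_lt_one hδ (show ((2 : ℝ)⁻¹) < 1 by norm_num)
  refine ⟨j, fun w hw => ?_⟩
  by_contra! h
  rw [inv_pow] at hj
  exact hb (Metric.mem_ball'.2 (h.trans hj)) hw

/-- For `f` flat on `X × Y` there are `g` flat on `X` and `h` flat on `Y` such that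
`φ = g ∘ π₁ + h ∘ π₂` vanishes on `X × Y` only and dominates `f`. -/
lemma exists_flat_dominating {m n : ℕ} {X : Set (Fin m → ℝ)} {Y : Set (Fin n → ℝ)}
    (hX : IsClosed X) (hY : IsClosed Y) {f : (Fin (m + n) → ℝ) → ℝ}
    (hf : ContDiff ℝ (⊤ : ℕ∞) f)
    (hfZ : ∀ k, ∀ z, projLeft m n z ∈ X → projRight m n z ∈ Y → iteratedFDeriv ℝ k f z = 0) :
    ∃ g : (Fin m → ℝ) → ℝ, ∃ h : (Fin n → ℝ) → ℝ,
      ContDiff ℝ (⊤ : ℕ∞) g ∧ ContDiff ℝ (⊤ : ℕ∞) h ∧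
      (∀ k, ∀ x ∈ X, iteratedFDeriv ℝ k g x = 0) ∧ (∀ k, ∀ y ∈ Y, iteratedFDeriv ℝ k h y = 0) ∧
      DominatedBy (fun z => g (projLeft m n z) + h (projRight m n z)) f := by
  classical
  set Z : Set (Fin (m + n) → ℝ) := {z | projLeft m n z ∈ X ∧ projRight m n z ∈ Y} with hZ
  obtain ⟨ε, hε, hεs, hεf⟩ := exists_slow_rate hf (Z := Z) fun k z hz => hfZ k z hz.1 hz.2
  obtain ⟨g, hg, hg0, hgX, hgε⟩ := exists_flat_ge m X ε hε hεs
  obtain ⟨h, hh, hh0, hhY, hhε⟩ := exists_flat_ge n Y ε hε hεs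
  refine ⟨g, h, hg, hh, hgX, hhY, hf, ?_⟩
  set φ : (Fin (m + n) → ℝ) → ℝ := fun z => g (projLeft m n z) + h (projRight m n z) with hφ
  let Far : (Fin (m + n) → ℝ) → ℕ → Prop := fun z j =>
    (∀ w ∈ X, ((2 : ℝ) ^ j)⁻¹ ≤ dist (projLeft m n z) w) ∨
      ∀ w ∈ Y, ((2 : ℝ) ^ j)⁻¹ ≤ dist (projRight m n z) w
  have hφ0 : ∀ z, 0 ≤ φ z := fun z => add_nonneg (hg0 _) (hh0 _)
  have hFar : ∀ z j, Far z j → ε j ≤ φ z := by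
    rintro z j (hj | hj)
    · exact (hgε j _ hj).trans (le_add_of_nonneg_right (hh0 _))
    · exact (hhε j _ hj).trans (le_add_of_nonneg_left (hg0 _))
  have hex : ∀ z ∉ Z, ∃ j, Far z j := by
    intro z hz
    by_cases hzX : projLeft m n z ∈ X
    · obtain ⟨j, hj⟩ := hY.exists_inv_two_pow_le_dist fun hzY => hz ⟨hzX, hzY⟩
      exact ⟨j, Or.inr hj⟩
    · obtain ⟨j, hj⟩ := hX.exists_inv_two_pow_le_dist hzX
      exact ⟨j, Or.inl hj⟩
  intro z₀ hz₀ i N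
  have hz₀Z : z₀ ∈ Z := by
    by_contra hn
    obtain ⟨j, hj⟩ := hex z₀ hn
    exact ((hε j).trans_le (hFar z₀ j hj)).ne' hz₀
  obtain ⟨K, hK⟩ := exists_nat_ge (‖z₀‖ + 1)
  set k := max K (max i N) with hk
  have hε0 : Tendsto ε atTop (𝓝 0) := by simpa using (hεs 0).tendsto_atTop_zero
  obtain ⟨J, hJ⟩ := eventually_atTop.1 ((hεf k).and (hε0.eventually_le_const one_pos))
  refine Asymptotics.IsBigO.of_bound 1 ?_
  filter_upwards [Metric.ball_mem_nhds z₀ (show 0 < ((2 : ℝ) ^ J)⁻¹ by positivity)] with z hz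
  rw [Metric.mem_ball] at hz
  rw [norm_norm, one_mul, Real.norm_of_nonneg (pow_nonneg (hφ0 z) N)]
  by_cases hzZ : z ∈ Z
  · rw [hfZ i z hzZ.1 hzZ.2, norm_zero]
    exact pow_nonneg (hφ0 z) N
  have hj := Nat.find_spec (hex z hzZ)
  have hmin := fun {l : ℕ} => Nat.find_min (hex z hzZ) (m := l)
  set j := Nat.find (hex z hzZ)
  have hJj : J < j := by
    have : ((2 : ℝ) ^ j)⁻¹ < ((2 : ℝ) ^ J)⁻¹ := by
      rcases hj with hj | hj
      · exact (hj _ hz₀Z.1).trans_lt ((dist_projLeft_le z z₀).trans_lt hz)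
      · exact (hj _ hz₀Z.2).trans_lt ((dist_projRight_le z z₀).trans_lt hz)
    rwa [inv_lt_inv₀ (by positivity) (by positivity), pow_lt_pow_iff_right₀ one_lt_two] at this
  obtain ⟨l, hl⟩ : ∃ l, j = l + 1 := Nat.exists_eq_succ_of_ne_zero (by omega)
  have hnl : ¬ Far z l := hmin (by omega)
  obtain ⟨⟨v, hv, hvz⟩, w, hw, hwz⟩ : (∃ v ∈ X, dist (projLeft m n z) v < ((2 : ℝ) ^ l)⁻¹) ∧
      ∃ w ∈ Y, dist (projRight m n z) w < ((2 : ℝ) ^ l)⁻¹ := by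
    simpa only [Far, not_or, not_forall, not_le, exists_prop] using hnl
  have hdist : dist z (Fin.append v w) ≤ 2 * ((2 : ℝ) ^ j)⁻¹ := by
    rw [hl, pow_succ, mul_inv, mul_left_comm, mul_inv_cancel₀ two_ne_zero, mul_one]
    exact dist_append_le (by positivity) hvz.le hwz.le
  have hzk : ‖z‖ ≤ k := by
    have h1 := norm_le_norm_add_norm_sub' z z₀
    rw [← dist_eq_norm] at h1
    have h2 : ((2 : ℝ) ^ J)⁻¹ ≤ 1 := inv_le_one_of_one_le₀ (one_le_pow₀ one_le_two)
    have h3 : (K : ℝ) ≤ k := by exact_mod_cast le_max_left _ _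
    linarith
  obtain ⟨h1, h2⟩ := hJ j hJj.le
  calc ‖iteratedFDeriv ℝ i f z‖ ≤ ε j ^ k :=
        h1 z hzk _ ⟨by rwa [projLeft_append], by rwa [projRight_append]⟩ hdist i
          ((le_max_left _ _).trans (le_max_right _ _))
    _ ≤ ε j ^ N := pow_le_pow_of_le_one (hε j).le h2 ((le_max_right _ _).trans (le_max_right _ _))
    _ ≤ φ z ^ N := pow_le_pow_left₀ (hε j).le (hFar z j hj) N

end FlatIdeals

/-- Reyes–van Quê / Calderón: `(m_X^∞ ∘ π₁, m_Y^∞ ∘ π₂) = m_{X×Y}^∞` as ideals of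
`C^∞(ℝ^{m+n})`, for closed `X ⊆ ℝ^m`, `Y ⊆ ℝ^n`. -/
theorem flat_ideal_of_product (m n : ℕ) (X : Set (Fin m → ℝ)) (Y : Set (Fin n → ℝ))
    (hX : IsClosed X) (hY : IsClosed Y) (f : SmoothAlg (m + n)) :
    f ∈ Ideal.span
        ({F : SmoothAlg (m + n) | ∃ g : SmoothAlg m, FlatOn m X g ∧
            ∀ x : Fin (m + n) → ℝ,
              (F : (Fin (m + n) → ℝ) → ℝ) x
                = (g : (Fin m → ℝ) → ℝ) (fun i => x (Fin.castAdd n i))} ∪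
         {F : SmoothAlg (m + n) | ∃ h : SmoothAlg n, FlatOn n Y h ∧
            ∀ x : Fin (m + n) → ℝ,
              (F : (Fin (m + n) → ℝ) → ℝ) x
                = (h : (Fin n → ℝ) → ℝ) (fun j => x (Fin.natAdd m j))}) ↔
      FlatOn (m + n)
        {x : Fin (m + n) → ℝ |
          (fun i => x (Fin.castAdd n i)) ∈ X ∧ (fun j => x (Fin.natAdd m j)) ∈ Y} f := by
  constructor
  · suffices h : Ideal.span _ ≤ flatIdeal (m + n) _ from fun hf => h hf
    rw [Ideal.span_le]
    rintro F (⟨g, hg, hF⟩ | ⟨h, hh, hF⟩) k x hx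
    · rw [show (F : (Fin (m + n) → ℝ) → ℝ) = fun y => (g : (Fin m → ℝ) → ℝ) (projLeft m n y) from
        funext hF]
      exact iteratedFDeriv_comp_clm_eq_zero _ g.2 (hg k _ hx.1)
    · rw [show (F : (Fin (m + n) → ℝ) → ℝ) = fun y => (h : (Fin n → ℝ) → ℝ) (projRight m n y) from
        funext hF]
      exact iteratedFDeriv_comp_clm_eq_zero _ h.2 (hh k _ hx.2)
  · intro hf
    obtain ⟨g, h, hg, hh, hgX, hhY, hdom⟩ := exists_flat_dominating hX hY f.2
      fun k z hzX hzY => hf k z ⟨hzX, hzY⟩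
    have hg' := hg.comp (projLeft m n).contDiff
    have hh' := hh.comp (projRight m n).contDiff
    have hq := contDiff_infty.2 fun k => DominatedBy.contDiff_inv_pow_smul (hg'.add hh') k hdom 1
    let G : SmoothAlg (m + n) := ⟨_, hg'⟩
    let H : SmoothAlg (m + n) := ⟨_, hh'⟩
    let Q : SmoothAlg (m + n) := ⟨_, hq⟩
    have hfQ : f = Q * G + Q * H := by
      ext z
      change (f : (Fin (m + n) → ℝ) → ℝ) z =
        ((g (projLeft m n z) + h (projRight m n z)) ^ 1)⁻¹ * (f : (Fin (m + n) → ℝ) → ℝ) z *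
            g (projLeft m n z) +
          ((g (projLeft m n z) + h (projRight m n z)) ^ 1)⁻¹ * (f : (Fin (m + n) → ℝ) → ℝ) z *
            h (projRight m n z)
      by_cases hz : g (projLeft m n z) + h (projRight m n z) = 0
      · rw [hdom.eq_zero hz]
        simp
      · field_simp
    rw [hfQ]
    refine Ideal.add_mem _ (Ideal.mul_mem_left _ _ (Ideal.subset_span (Or.inl ?_)))
      (Ideal.mul_mem_left _ _ (Ideal.subset_span (Or.inr ?_)))
    · exact ⟨⟨g, hg⟩, hgX, fun _ => rfl⟩
    · exact ⟨⟨h, hh⟩, hhY, fun _ => rfl⟩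
end
end

section
/- Let X ⊆ ℝ^n be a closed subset with X ≠ ∅ and X ≠ ℝ^n. Then the ideal m_X^∞ of C∞(ℝ^n) is not countably generated: there is no countable subset S ⊆ C∞(ℝ^n) such that the ideal generated by S equals m_X^∞. -/
noncomputable section

open Filter Topology Metric

/-- A smooth function all of whose derivatives vanish on a closed set `X` is, together with its
derivatives, bounded on balls by any power of the distance to `X`. -/
theorem exists_norm_iteratedFDeriv_le_infDist_pow {E F : Type*} [NormedAddCommGroup E]
    [NormedSpace ℝ E] [ProperSpace E] [NormedAddCommGroup F] [NormedSpace ℝ F] {X : Set E}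
    (hX : IsClosed X) {x₀ : E} (hx₀ : x₀ ∈ X) {g : E → F} (hg : ContDiff ℝ (⊤ : ℕ∞) g)
    (hflat : ∀ k : ℕ, ∀ x ∈ X, iteratedFDeriv ℝ k g x = 0) (K j : ℕ) (R : ℝ) :
    ∃ C, 0 ≤ C ∧ ∀ x ∈ closedBall x₀ R, ‖iteratedFDeriv ℝ j g x‖ ≤ C * infDist x X ^ K := by
  induction K generalizing j R with
  | zero =>
    obtain ⟨C, hC⟩ := (isCompact_closedBall x₀ R).exists_bound_of_continuousOn
      (hg.continuous_iteratedFDeriv (m := j) (by exact_mod_cast le_top)).continuousOn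
    refine ⟨max C 0, le_max_right _ _, fun x hx => ?_⟩
    simpa using Or.inl (hC x hx)
  | succ K ih =>
    obtain ⟨C, hC0, hC⟩ := ih (j + 1) (2 * R)
    refine ⟨C, hC0, fun x hx => ?_⟩
    obtain ⟨y, hy, hxy⟩ := hX.exists_infDist_eq_dist ⟨x₀, hx₀⟩ x
    rw [mem_closedBall] at hx
    have hle : dist x y ≤ dist x x₀ := hxy ▸ infDist_le_dist_of_mem hx₀
    have hball : segment ℝ y x ⊆ closedBall x₀ (2 * R) := by
      refine (convex_closedBall x₀ (2 * R)).segment_subset ?_ ?_ <;> rw [mem_closedBall]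
      · linarith [dist_triangle_left y x₀ x]
      · linarith [dist_nonneg (x := x) (y := x₀)]
    have key := Convex.norm_image_sub_le_of_norm_fderiv_le (𝕜 := ℝ)
      (f := iteratedFDeriv ℝ j g) (C := C * infDist x X ^ K) (s := segment ℝ y x)
      (fun z _ => (hg.differentiable_iteratedFDeriv
        (by exact_mod_cast WithTop.coe_lt_top j)) z)
      (fun z hz => by
        rw [norm_fderiv_iteratedFDeriv]
        refine (hC z (hball hz)).trans ?_
        have hz' : infDist z X ≤ infDist x X := by
          rw [hxy]
          refine (infDist_le_dist_of_mem hy).trans ?_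
          have := dist_add_dist_of_mem_segment hz
          rw [dist_comm y z, dist_comm y x] at this
          linarith [dist_nonneg (x := z) (y := x)]
        gcongr
        exact infDist_nonneg)
      (convex_segment y x) (left_mem_segment ℝ y x) (right_mem_segment ℝ y x)
    rw [hflat j y hy, sub_zero, ← dist_eq_norm, ← hxy] at key
    rw [pow_succ, ← mul_assoc]
    exact key

/-- Any element of the ideal generated by countably many smooth functions is bounded near a
point by a multiple of a finite sum of absolute values of generators. -/
theorem eventually_abs_le_sum_of_mem_span {n : ℕ} (x₀ : Fin n → ℝ) {S : Set (SmoothAlg n)}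
    {g : ℕ → SmoothAlg n} (hS : S ⊆ Set.range g) {f : SmoothAlg n} (hf : f ∈ Ideal.span S) :
    ∃ N : ℕ, ∀ᶠ x in 𝓝 x₀, |f.1 x| ≤ N * ∑ i ∈ Finset.range N, |(g i).1 x| := by
  have mono : ∀ {M N : ℕ} (x : Fin n → ℝ), M ≤ N →
      ∑ i ∈ Finset.range M, |(g i).1 x| ≤ ∑ i ∈ Finset.range N, |(g i).1 x| := fun x h =>
    Finset.sum_le_sum_of_subset_of_nonneg (Finset.range_mono h) fun _ _ _ => abs_nonneg _
  induction hf using Submodule.span_induction with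
  | mem s hs =>
    obtain ⟨i, rfl⟩ := hS hs
    refine ⟨i + 1, Eventually.of_forall fun x => ?_⟩
    have h1 : |(g i).1 x| ≤ ∑ j ∈ Finset.range (i + 1), |(g j).1 x| :=
      Finset.single_le_sum (f := fun j => |(g j).1 x|) (fun _ _ => abs_nonneg _)
        (Finset.self_mem_range_succ i)
    refine h1.trans (le_mul_of_one_le_left ((abs_nonneg _).trans h1) ?_)
    exact_mod_cast Nat.succ_pos i
  | zero => exact ⟨0, Eventually.of_forall fun x => by simp⟩
  | add a b _ _ ha hb =>
    obtain ⟨M, hM⟩ := ha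
    obtain ⟨N, hN⟩ := hb
    refine ⟨M + N, ?_⟩
    filter_upwards [hM, hN] with x hMx hNx
    have h1 := mul_le_mul_of_nonneg_left (mono x (Nat.le_add_right M N)) (Nat.cast_nonneg' (α := ℝ) M)
    have h2 := mul_le_mul_of_nonneg_left (mono x (Nat.le_add_left N M)) (Nat.cast_nonneg' (α := ℝ) N)
    have h3 : |(a + b).1 x| ≤ |a.1 x| + |b.1 x| := abs_add_le _ _
    rw [Nat.cast_add, add_mul]
    linarith
  | smul a b _ hb =>
    obtain ⟨N, hN⟩ := hb
    obtain ⟨A, hA⟩ := exists_nat_gt |a.1 x₀|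
    have hcont : Continuous fun x => |a.1 x| := (show ContDiff ℝ (⊤ : ℕ∞) a.1 from a.2).continuous.abs
    refine ⟨A * N + N, ?_⟩
    filter_upwards [hN, hcont.continuousAt.eventually_lt_const hA] with x hNx hAx
    have h3 : |(a • b).1 x| = |a.1 x| * |b.1 x| := abs_mul _ _
    rw [h3]
    have h0 : 0 ≤ ∑ i ∈ Finset.range (A * N + N), |(g i).1 x| :=
      Finset.sum_nonneg fun _ _ => abs_nonneg _
    calc |a.1 x| * |b.1 x| ≤ A * (N * ∑ i ∈ Finset.range N, |(g i).1 x|) := by gcongr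
      _ ≤ A * (N * ∑ i ∈ Finset.range (A * N + N), |(g i).1 x|) := by
        gcongr; exact Nat.le_add_left _ _
      _ ≤ _ := by
        push_cast
        nlinarith [mul_nonneg (Nat.cast_nonneg' (α := ℝ) N) h0]

/-- Near a frontier point of `X` there are points outside `X` at which finitely many given flat
functions are small compared with a given power of the distance to `X`. -/
theorem exists_notMem_sum_lt_infDist_pow {n : ℕ} {X : Set (Fin n → ℝ)} (hX : IsClosed X)
    {x₀ : Fin n → ℝ} (hx₀ : x₀ ∈ X) (hx₀' : x₀ ∈ closure Xᶜ) {g : ℕ → SmoothAlg n}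
    (hg : ∀ i, FlatOn n X (g i)) (m : ℕ) {ε : ℝ} (hε : 0 < ε) :
    ∃ x, x ∉ X ∧ dist x x₀ < ε ∧
      m * ∑ i ∈ Finset.range m, |(g i).1 x| < (infDist x X / 2) ^ m := by
  have hb : ∀ i, ∃ C, 0 ≤ C ∧ ∀ x ∈ closedBall x₀ 1, |(g i).1 x| ≤ C * infDist x X ^ (m + 1) := by
    intro i
    simpa using exists_norm_iteratedFDeriv_le_infDist_pow hX hx₀ (g i).2 (hg i) (m + 1) 0 1
  choose C hC0 hC using hb
  set D : ℝ := m * ∑ i ∈ Finset.range m, C i with hD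
  have hD0 : 0 ≤ D := mul_nonneg (Nat.cast_nonneg' m) (Finset.sum_nonneg fun i _ => hC0 i)
  have hδ : 0 < min (min ε 1) ((1 / 2) ^ m / (D + 1)) := by positivity
  obtain ⟨x, hxX, hx⟩ := Metric.mem_closure_iff.1 hx₀' _ hδ
  rw [dist_comm, lt_min_iff, lt_min_iff, lt_div_iff₀ (by positivity)] at hx
  obtain ⟨⟨hx1, hx2⟩, hx3⟩ := hx
  refine ⟨x, hxX, hx1, ?_⟩
  have hd : 0 < infDist x X := (hX.notMem_iff_infDist_pos ⟨x₀, hx₀⟩).1 hxX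
  have hdle : infDist x X ≤ dist x x₀ := infDist_le_dist_of_mem hx₀
  calc m * ∑ i ∈ Finset.range m, |(g i).1 x|
      ≤ m * ∑ i ∈ Finset.range m, C i * infDist x X ^ (m + 1) := by
        gcongr with i; exact hC i x (mem_closedBall.2 hx2.le)
    _ = infDist x X ^ m * (infDist x X * D) := by rw [← Finset.sum_mul, hD]; ring
    _ < infDist x X ^ m * (1 / 2) ^ m := by
        gcongr
        nlinarith
    _ = (infDist x X / 2) ^ m := by rw [← mul_pow]; ring

/-- Rescaled bumps around points `p m` at distance `d m ≤ 1` from `X`, with heights `(d m / 2) ^ m`,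
sum to a smooth function which is flat on `X`. -/
theorem exists_flatOn_pow_le {n : ℕ} {X : Set (Fin n → ℝ)} {p : ℕ → Fin n → ℝ}
    (hpos : ∀ m, 0 < infDist (p m) X) (hle : ∀ m, infDist (p m) X ≤ 1) :
    ∃ f : SmoothAlg n, FlatOn n X f ∧ ∀ m, (infDist (p m) X / 2) ^ m ≤ f.1 (p m) := by
  set d : ℕ → ℝ := fun m => infDist (p m) X with hd
  let ψ : ContDiffBump (0 : Fin n → ℝ) := ⟨1 / 4, 1 / 2, by norm_num, by norm_num⟩
  have hψ : ∀ k : ℕ, ContDiff ℝ k ψ := fun k => ψ.contDiff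
  have hbound : ∀ k : ℕ, ∃ C, ∀ x, ‖iteratedFDeriv ℝ k ψ x‖ ≤ C := fun k =>
    ((hψ k).continuous_iteratedFDeriv le_rfl).bounded_above_of_compact_support
      (ψ.hasCompactSupport.iteratedFDeriv k)
  choose C hC using hbound
  have hC0 : ∀ k, 0 ≤ C k := fun k => (norm_nonneg _).trans (hC k 0)
  let φ : ℕ → (Fin n → ℝ) → ℝ := fun m z => (d m / 2) ^ m • ψ ((d m)⁻¹ • (z - p m))
  have hscale : ∀ m, ContDiff ℝ (⊤ : ℕ∞) fun z => ψ ((d m)⁻¹ • (z - p m)) := fun m =>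
    ψ.contDiff.comp ((contDiff_id.sub contDiff_const).const_smul (d m)⁻¹)
  have hφ : ∀ m, ContDiff ℝ (⊤ : ℕ∞) (φ m) := fun m => (hscale m).const_smul _
  have hderiv : ∀ (k m : ℕ) (z : Fin n → ℝ), iteratedFDeriv ℝ k (φ m) z =
      (d m / 2) ^ m • (d m)⁻¹ ^ k • iteratedFDeriv ℝ k ψ ((d m)⁻¹ • (z - p m)) := by
    intro k m z
    have h1 := iteratedFDeriv_const_smul_apply (𝕜 := ℝ) (i := k) (x := z) (a := (d m / 2) ^ m)
      (((hscale m).of_le (by exact_mod_cast le_top)).contDiffAt)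
    refine h1.trans ?_
    rw [iteratedFDeriv_comp_sub (f := fun w => ψ ((d m)⁻¹ • w)) k (p m) z,
      iteratedFDeriv_comp_const_smul _ (hψ k)]
  let v : ℕ → ℕ → ℝ := fun k m => (d m / 2) ^ m * ((d m)⁻¹ ^ k * C k)
  have hv : ∀ (k m : ℕ) (z : Fin n → ℝ), ‖iteratedFDeriv ℝ k (φ m) z‖ ≤ v k m := by
    intro k m z
    have := (hpos m).le
    rw [hderiv, norm_smul, norm_smul, Real.norm_of_nonneg (by positivity),
      Real.norm_of_nonneg (by positivity)]
    simp only [v]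
    gcongr
    exact hC k _
  have hsum : ∀ k, Summable (v k) := by
    intro k
    refine Summable.of_norm_bounded_eventually_nat
      ((summable_geometric_of_lt_one (r := (1 / 2 : ℝ)) (by norm_num) (by norm_num)).mul_left (C k)) ?_
    filter_upwards [eventually_ge_atTop k] with m hm
    have hdm : 0 < d m := hpos m
    have hCk := hC0 k
    rw [Real.norm_of_nonneg (by positivity)]
    obtain ⟨j, rfl⟩ := Nat.exists_eq_add_of_le hm
    have h1 : v k (k + j) = d (k + j) ^ j * (C k * (1 / 2) ^ (k + j)) := by
      simp only [v, div_pow, inv_pow, pow_add, one_div]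
      field_simp
    rw [h1]
    exact mul_le_of_le_one_left (by positivity) (pow_le_one₀ hdm.le (hle _))
  have hsmooth : ContDiff ℝ (⊤ : ℕ∞) fun z => ∑' m, φ m z :=
    contDiff_tsum hφ (fun k _ => hsum k) fun k m z _ => hv k m z
  refine ⟨⟨_, hsmooth⟩, fun k z hz => ?_, fun m => ?_⟩
  · change iteratedFDeriv ℝ k (fun z => ∑' m, φ m z) z = 0
    rw [iteratedFDeriv_tsum hφ (fun k _ => hsum k) (fun k m z _ => hv k m z) (k := k) le_top]
    refine (tsum_congr fun m => ?_).trans tsum_zero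
    have hzero : iteratedFDeriv ℝ k ψ ((d m)⁻¹ • (z - p m)) = 0 := by
      by_contra hne
      have hmem := support_iteratedFDeriv_subset k (Function.mem_support.2 hne)
      rw [ψ.tsupport_eq, mem_closedBall_zero_iff, norm_smul, norm_inv,
        Real.norm_of_nonneg (hpos m).le, ← dist_eq_norm, inv_mul_le_iff₀ (hpos m)] at hmem
      have h1 : d m ≤ dist z (p m) := by
        rw [dist_comm]; exact infDist_le_dist_of_mem hz
      have h2 : dist z (p m) ≤ d m * (1 / 2) := hmem
      linarith [show 0 < d m from hpos m]
    rw [hderiv, hzero, smul_zero, smul_zero]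
  · have hnonneg : ∀ i, 0 ≤ φ i (p m) := fun i =>
      mul_nonneg (pow_nonneg (div_nonneg (hpos i).le zero_le_two) _) ψ.nonneg
    have hs : Summable fun i => φ i (p m) :=
      Summable.of_norm_bounded (hsum 0) fun i => by simpa using hv 0 i (p m)
    have h1 : φ m (p m) = (d m / 2) ^ m := by
      have : ψ 0 = 1 := ψ.one_of_mem_closedBall (mem_closedBall_self ψ.rIn_pos.le)
      simp [φ, this]
    exact h1 ▸ hs.le_tsum m fun i _ => hnonneg i

/-- For a closed set `∅ ≠ X ⊊ ℝ^n`, the ideal `m_X^∞` of `C^∞(ℝ^n)` is not countably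
generated. -/
theorem flat_ideal_not_countably_generated (n : ℕ) (X : Set (Fin n → ℝ)) (hX : IsClosed X)
    (hne : X.Nonempty) (hproper : X ≠ Set.univ) :
    ¬ ∃ S : Set (SmoothAlg n), S.Countable ∧
        ∀ f : SmoothAlg n, f ∈ Ideal.span S ↔ FlatOn n X f := by
  rintro ⟨S, hS, hspan⟩
  obtain ⟨g, hg⟩ := (hS.insert 0).exists_eq_range (Set.insert_nonempty 0 S)
  have hflat : ∀ i, FlatOn n X (g i) := fun i => by
    rw [← hspan]
    rcases hg.symm ▸ Set.mem_range_self i with h | h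
    · rw [h]; exact zero_mem _
    · exact Ideal.subset_span h
  obtain ⟨x₀, hx₀⟩ := nonempty_frontier_iff.2 ⟨hne, hproper⟩
  rw [frontier_eq_closure_inter_closure, hX.closure_eq] at hx₀
  choose p hpX hpx hpg using fun m : ℕ =>
    exists_notMem_sum_lt_infDist_pow hX hx₀.1 hx₀.2 hflat m (Nat.one_div_pos_of_nat (α := ℝ) (n := m))
  obtain ⟨f, hf, hpf⟩ := exists_flatOn_pow_le (X := X) (p := p)
    (fun m => (hX.notMem_iff_infDist_pos hne).1 (hpX m))
    (fun m => (infDist_le_dist_of_mem hx₀.1).trans ((hpx m).le.trans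
      ((div_le_one (by positivity)).2 (by linarith [Nat.cast_nonneg' (α := ℝ) m]))))
  obtain ⟨N, hN⟩ := eventually_abs_le_sum_of_mem_span x₀
    (hg ▸ Set.subset_insert 0 S) ((hspan f).2 hf)
  have hp : Tendsto p atTop (𝓝 x₀) := tendsto_iff_dist_tendsto_zero.2 <|
    squeeze_zero (fun _ => dist_nonneg) (fun m => (hpx m).le) tendsto_one_div_add_atTop_nhds_zero_nat
  obtain ⟨m, hm, hNm⟩ := ((hp.eventually hN).and (eventually_ge_atTop N)).exists
  have h1 : (N : ℝ) * ∑ i ∈ Finset.range N, |(g i).1 (p m)| ≤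
      m * ∑ i ∈ Finset.range m, |(g i).1 (p m)| := by
    gcongr
  linarith [hpg m, hpf m, le_abs_self (f.1 (p m))]
end
end

section
/- Every ℝ-algebra homomorphism φ : C∞(ℝ^n) → ℝ is evaluation at a unique point: there exists a unique p ∈ ℝ^n such that φ(f) = f(p) for all f ∈ C∞(ℝ^n). -/
noncomputable section

/-- A smooth function lying in the kernel of a character has a zero. -/
theorem SmoothAlg.exists_eq_zero_of_algHom_eq_zero {n : ℕ} (φ : SmoothAlg n →ₐ[ℝ] ℝ)
    (g : SmoothAlg n) (hg : φ g = 0) : ∃ q, (g : (Fin n → ℝ) → ℝ) q = 0 := by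
  by_contra! hne
  have hsmooth : ContDiff ℝ (⊤ : ℕ∞) (g : (Fin n → ℝ) → ℝ) := g.2
  let ginv : SmoothAlg n := ⟨fun x => ((g : (Fin n → ℝ) → ℝ) x)⁻¹, hsmooth.inv hne⟩
  have hmul : g * ginv = 1 := Subtype.ext (funext fun x => mul_inv_cancel₀ (hne x))
  have h := congrArg φ hmul
  rw [map_mul, hg, zero_mul, map_one] at h
  exact zero_ne_one h

/-- The `i`-th coordinate function, as an element of `SmoothAlg n`. -/
def SmoothAlg.coord {n : ℕ} (i : Fin n) : SmoothAlg n :=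
  ⟨fun x => x i,
    (contDiff_apply ℝ ℝ i : ContDiff ℝ (⊤ : ℕ∞) fun x : Fin n → ℝ => x i)⟩

/-- Every `ℝ`-algebra homomorphism `C^∞(ℝ^n) → ℝ` is evaluation at a unique point. -/
theorem algHom_eq_eval (n : ℕ) (φ : SmoothAlg n →ₐ[ℝ] ℝ) :
    ∃! p : Fin n → ℝ, ∀ f : SmoothAlg n, φ f = (f : (Fin n → ℝ) → ℝ) p := by
  refine ⟨fun i => φ (SmoothAlg.coord i), fun f => ?_, fun q hq => ?_⟩
  · let g : SmoothAlg n := (f - algebraMap ℝ _ (φ f)) ^ 2 +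
      ∑ i, (SmoothAlg.coord i - algebraMap ℝ _ (φ (SmoothAlg.coord i))) ^ 2
    have hg : φ g = 0 := by simp [g]
    obtain ⟨q, hq⟩ := SmoothAlg.exists_eq_zero_of_algHom_eq_zero φ g hg
    have hval : (g : (Fin n → ℝ) → ℝ) q = ((f : (Fin n → ℝ) → ℝ) q - φ f) ^ 2 +
        ∑ i, (q i - φ (SmoothAlg.coord i)) ^ 2 := by
      simp [g, SmoothAlg.coord]
    rw [hval, add_eq_zero_iff_of_nonneg (sq_nonneg _)
      (Finset.sum_nonneg fun _ _ => sq_nonneg _),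
      Finset.sum_eq_zero_iff_of_nonneg fun _ _ => sq_nonneg _] at hq
    have hqp : q = fun i => φ (SmoothAlg.coord i) :=
      funext fun i => sub_eq_zero.mp (pow_eq_zero_iff two_ne_zero |>.mp (hq.2 i (Finset.mem_univ i)))
    rw [← hqp]
    exact (sub_eq_zero.mp (pow_eq_zero_iff two_ne_zero |>.mp hq.1)).symm
  · exact funext fun i => (hq (SmoothAlg.coord i)).symm
end
end

section
/- Let G be a finite group acting linearly on ℝ^n (i.e. G a finite subgroup of GL(n,ℝ)), and let p_1,…,p_l be G-invariant polynomials in n variables which generate the ℝ-algebra ℝ[x_1,…,x_n]^G of G-invariant polynomials. Then every G-invariant smooth function f ∈ C∞(ℝ^n) (meaning f(γ·x) = f(x) for all γ ∈ G, x ∈ ℝ^n) can be written as a smooth function of the invariant polynomials: there exists F ∈ C∞(ℝ^l) with f(x) = F(p_1(x),…,p_l(x)) for all x ∈ ℝ^n. Equivalently, the image of the ℝ-algebra homomorphism C∞(ℝ^l) → C∞(ℝ^n), F ↦ F ∘ (p_1,…,p_l), is exactly the subalgebra of G-invariant smooth functions. -/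
noncomputable section

section Schwarz

open MeasureTheory Filter Topology
open scoped ContDiff

theorem LinearIsometryEquiv.integral_map_eq {Z V W : Type*} [MeasurableSpace Z] {μ : Measure Z}
    [NormedAddCommGroup V] [NormedSpace ℝ V] [NormedAddCommGroup W] [NormedSpace ℝ W]
    (Λ : V ≃ₗᵢ[ℝ] W) (g : Z → V) : ∫ z, Λ (g z) ∂μ = Λ (∫ z, g z ∂μ) :=
  ContinuousLinearEquiv.integral_comp_comm Λ.toContinuousLinearEquiv g

/-- Differentiation under the integral sign to all orders, with uniform bounds. -/
theorem contDiff_integral_of_bounded {Z E F : Type*} [MeasurableSpace Z] {μ : Measure Z}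
    [IsProbabilityMeasure μ] [NormedAddCommGroup E] [NormedSpace ℝ E]
    [NormedAddCommGroup F] [NormedSpace ℝ F] [CompleteSpace F]
    {G : Z → E → F} {B : ℕ → ℝ} (hG : ∀ z, ContDiff ℝ ∞ (G z))
    (hmeas : ∀ k a, AEStronglyMeasurable (fun z => iteratedFDeriv ℝ k (G z) a) μ)
    (hB : ∀ k z a, ‖iteratedFDeriv ℝ k (G z) a‖ ≤ B k) :
    ContDiff ℝ ∞ (fun a => ∫ z, G z a ∂μ) ∧
      ∀ k a, ‖iteratedFDeriv ℝ k (fun a => ∫ z, G z a ∂μ) a‖ ≤ B k := by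
  have hint : ∀ k a, Integrable (fun z => iteratedFDeriv ℝ k (G z) a) μ := fun k a =>
    Integrable.of_bound (hmeas k a) (B k) (.of_forall fun z => hB k z a)
  have hderiv : ∀ k a, HasFDerivAt (fun a => ∫ z, iteratedFDeriv ℝ k (G z) a ∂μ)
      (∫ z, iteratedFDeriv ℝ (k + 1) (G z) a ∂μ).curryLeft a := by
    intro k a
    let Λ : (E [×(k + 1)]→L[ℝ] F) ≃ₗᵢ[ℝ] (E →L[ℝ] E [×k]→L[ℝ] F) :=
      continuousMultilinearCurryLeftEquiv ℝ (fun _ : Fin (k + 1) => E) F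
    have hΛ : ∀ z x, HasFDerivAt (iteratedFDeriv ℝ k (G z))
        (Λ (iteratedFDeriv ℝ (k + 1) (G z) x)) x := by
      intro z x
      have h := ((hG z).differentiable_iteratedFDeriv (m := k)
        (by exact_mod_cast WithTop.coe_lt_top _)) x
      have h2 := h.hasFDerivAt
      rw [fderiv_iteratedFDeriv] at h2
      exact h2
    have hc : Λ (∫ z, iteratedFDeriv ℝ (k + 1) (G z) a ∂μ)
        = ∫ z, Λ (iteratedFDeriv ℝ (k + 1) (G z) a) ∂μ := by
      exact (LinearIsometryEquiv.integral_map_eq (Z := Z) (V := E [×(k + 1)]→L[ℝ] F)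
        (W := E →L[ℝ] E [×k]→L[ℝ] F) Λ
        (fun z => iteratedFDeriv ℝ (k + 1) (G z) a)).symm
    change HasFDerivAt _ (Λ _) a
    rw [hc]
    refine hasFDerivAt_integral_of_dominated_of_fderiv_le
      (F' := fun x z => Λ (iteratedFDeriv ℝ (k + 1) (G z) x)) (bound := fun _ => B (k + 1))
      Filter.univ_mem (.of_forall fun x => hmeas k x) (hint k a) ?_ ?_ (integrable_const _) ?_
    · exact Λ.continuous.comp_aestronglyMeasurable (hmeas (k + 1) a)
    · exact .of_forall fun z x _ => by
        rw [LinearIsometryEquiv.norm_map]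
        exact hB _ _ _
    · exact .of_forall fun z x _ => hΛ z x
  have hT : HasFTaylorSeriesUpTo ∞ (fun a => ∫ z, G z a ∂μ)
      (fun a k => ∫ z, iteratedFDeriv ℝ k (G z) a ∂μ) := by
    refine ⟨fun a => ?_, fun m _ a => hderiv m a,
      fun m _ => continuous_iff_continuousAt.2 fun a => (hderiv m a).continuousAt⟩
    change (continuousMultilinearCurryFin0 ℝ E F) _ = _
    refine (ContinuousLinearEquiv.integral_comp_comm (continuousMultilinearCurryFin0 ℝ E
      F).toContinuousLinearEquiv _).symm.trans ?_
    rfl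
  refine ⟨hT.contDiff, fun k a => ?_⟩
  have : iteratedFDeriv ℝ k (fun a => ∫ z, G z a ∂μ) a = ∫ z, iteratedFDeriv ℝ k (G z) a ∂μ :=
    (hT.eq_iteratedFDeriv (by exact_mod_cast le_top) a).symm
  rw [this]
  exact (norm_integral_le_of_norm_le_const (.of_forall fun z => hB k z a)).trans (by simp)

/-- A tempered regularization of the inverse on the real line. -/
theorem exists_hasTemperateGrowth_eq_inv_real :
    ∃ η : ℝ → ℝ, η.HasTemperateGrowth ∧ ∀ u, 1 ≤ u → η u = u⁻¹ := by
  let η : ℝ → ℝ := fun u => Real.smoothTransition (4 * u - 2) * u⁻¹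
  have h0 : ∀ u, u < 1 / 2 → η u = 0 := fun u hu => by
    simp only [η]
    rw [Real.smoothTransition.zero_of_nonpos (by linarith), zero_mul]
  have h1 : ∀ u, 3 / 4 ≤ u → η u = u⁻¹ := fun u hu => by
    simp only [η]
    rw [Real.smoothTransition.one_of_one_le (by linarith), one_mul]
  have hs : ContDiff ℝ ∞ η := by
    rw [contDiff_iff_contDiffAt]
    intro u
    rcases lt_or_ge u (1 / 2) with hu | hu
    · exact (contDiffAt_const (c := (0 : ℝ))).congr_of_eventuallyEq
        (Filter.eventually_of_mem (Iio_mem_nhds hu) fun v hv => h0 v hv)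
    · exact ((Real.smoothTransition.contDiff.comp (by fun_prop)).contDiffAt).mul
        (contDiffAt_id.inv (by simp; linarith))
  refine ⟨η, ⟨hs, fun n => ?_⟩, fun u hu => h1 u (by linarith)⟩
  obtain ⟨C, hC⟩ := isCompact_Icc.exists_bound_of_continuousOn (s := Set.Icc (0 : ℝ) 1)
    (hs.continuous_iteratedFDeriv (m := n) (by exact_mod_cast le_top)).continuousOn
  refine ⟨0, max C (max 0 n.factorial), fun u => ?_⟩
  rw [pow_zero, mul_one]
  rcases lt_or_ge u 0 with hu | hu
  · have : η =ᶠ[𝓝 u] fun _ => 0 :=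
      Filter.eventually_of_mem (Iio_mem_nhds (show u < 1 / 2 by linarith)) fun v hv => h0 v hv
    rw [(this.iteratedFDeriv ℝ n).eq_of_nhds]
    simp
  rcases le_or_gt u 1 with hu1 | hu1
  · exact (hC u ⟨hu, hu1⟩).trans (le_max_left _ _)
  · have : η =ᶠ[𝓝 u] Inv.inv :=
      Filter.eventually_of_mem (Ioi_mem_nhds (show 3 / 4 < u by linarith))
        fun v hv => h1 v (le_of_lt hv)
    rw [(this.iteratedFDeriv ℝ n).eq_of_nhds, norm_iteratedFDeriv_eq_norm_iteratedDeriv,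
      iteratedDeriv_eq_iterate, iter_deriv_inv]
    refine le_trans ?_ (le_max_right _ _)
    refine le_trans ?_ (le_max_right _ _)
    rw [norm_mul, norm_mul, norm_pow, norm_neg, norm_one, one_pow, one_mul]
    have : ‖u ^ (-1 - n : ℤ)‖ ≤ 1 := by
      rw [norm_zpow, Real.norm_of_nonneg hu]
      exact zpow_le_one_of_nonpos₀ hu1.le (by omega)
    calc _ ≤ ‖(n.factorial : ℝ)‖ * 1 := by gcongr
      _ = _ := by simp

/-- A tempered regularization of the complex inverse. -/
theorem exists_hasTemperateGrowth_eq_inv :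
    ∃ κ : ℂ → ℂ, κ.HasTemperateGrowth ∧ ∀ v, 1 ≤ ‖v‖ → κ v = v⁻¹ := by
  obtain ⟨η, hη, h1⟩ := exists_hasTemperateGrowth_eq_inv_real
  refine ⟨fun v => (η (‖v‖ ^ 2) : ℂ) * starRingEnd ℂ v, ?_, fun v hv => ?_⟩
  · have hc : Function.HasTemperateGrowth (fun v : ℂ => starRingEnd ℂ v) :=
      Complex.conjCLE.toContinuousLinearMap.hasTemperateGrowth
    have he : Function.HasTemperateGrowth (fun v : ℂ => ((η (‖v‖ ^ 2) : ℝ) : ℂ)) :=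
      Function.HasTemperateGrowth.comp (g := Complex.ofReal)
        Function.Complex.hasTemperateGrowth_ofReal
        (hη.comp (Function.hasTemperateGrowth_norm_sq (H := ℂ)))
    exact he.mul hc
  · change ((η (‖v‖ ^ 2) : ℝ) : ℂ) * _ = _
    rw [h1 _ (one_le_pow₀ hv), Complex.inv_def, Complex.normSq_eq_norm_sq, mul_comm]

/-- The normalized Haar measure on the torus. -/
def torusMeasure (n : ℕ) : Measure (UnitAddTorus (Fin n)) :=
  Measure.pi fun _ => AddCircle.haarAddCircle

instance (n : ℕ) : IsProbabilityMeasure (torusMeasure n) :=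
  inferInstanceAs (IsProbabilityMeasure (Measure.pi _))

instance (n : ℕ) : (torusMeasure n).IsAddHaarMeasure :=
  inferInstanceAs (Measure.IsAddHaarMeasure (Measure.pi _))

/-- The standard embedding of the torus in `ℂ^n`. -/
def torusEmb {n : ℕ} (z : UnitAddTorus (Fin n)) : Fin n → ℂ := fun j => fourier 1 (z j)

theorem continuous_torusEmb {n : ℕ} : Continuous (torusEmb (n := n)) :=
  continuous_pi fun j => (fourier 1).continuous.comp (continuous_apply j)

/-- The Fourier coefficients of the restriction to the torus of a function on `ℂ^n`. -/
def torusCoeff {n : ℕ} (Φ : (Fin n → ℂ) → ℂ) (m : Fin n → ℤ) : ℂ :=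
  ∫ z, UnitAddTorus.mFourier (-m) z * Φ (torusEmb z) ∂torusMeasure n

/-- The derivation of functions on `ℂ^n` induced by translation of the torus. -/
def torusDeriv {n : ℕ} (i : Fin n) (Φ : (Fin n → ℂ) → ℂ) (u : Fin n → ℂ) : ℂ :=
  fderiv ℝ Φ u fun j => 2 * Real.pi * Complex.I * ((Pi.single i 1 : Fin n → ℝ) j : ℝ) * u j

theorem contDiff_torusDeriv {n : ℕ} (i : Fin n) {Φ : (Fin n → ℂ) → ℂ} (h : ContDiff ℝ ∞ Φ) :
    ContDiff ℝ ∞ (torusDeriv i Φ) := by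
  unfold torusDeriv
  exact (h.fderiv_right (m := ∞) (by simp)).clm_apply (by fun_prop)

theorem fourier_add_right (m : ℤ) (x y : UnitAddCircle) :
    fourier m (x + y) = fourier m x * fourier m y := by
  simp [fourier_apply, smul_add, AddCircle.toCircle_add]

theorem mFourier_add_right {n : ℕ} (m : Fin n → ℤ) (x y : UnitAddTorus (Fin n)) :
    UnitAddTorus.mFourier m (x + y) = UnitAddTorus.mFourier m x * UnitAddTorus.mFourier m y := by
  simp only [UnitAddTorus.mFourier, ContinuousMap.coe_mk, ← Finset.prod_mul_distrib]
  exact Finset.prod_congr rfl fun i _ => fourier_add_right _ _ _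

theorem norm_mFourier_apply {n : ℕ} (m : Fin n → ℤ) (x : UnitAddTorus (Fin n)) :
    ‖UnitAddTorus.mFourier m x‖ = 1 := by
  simp only [UnitAddTorus.mFourier, ContinuousMap.coe_mk, norm_prod, fourier_apply,
    Circle.norm_coe, Finset.prod_const_one]

theorem integrable_torus {n : ℕ} {g : UnitAddTorus (Fin n) → ℂ} (hg : Continuous g) :
    Integrable g (torusMeasure n) :=
  hg.integrable_of_hasCompactSupport (.of_compactSpace _)

theorem torusCoeff_torusDeriv {n : ℕ} (i : Fin n) {Φ : (Fin n → ℂ) → ℂ} (hΦ : ContDiff ℝ ∞ Φ)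
    (m : Fin n → ℤ) :
    torusCoeff (torusDeriv i Φ) m = 2 * Real.pi * Complex.I * m i * torusCoeff Φ m := by
  let a : ℝ → UnitAddTorus (Fin n) := fun h j => ((h * (Pi.single i 1 : Fin n → ℝ) j : ℝ))
  have ha0 : a 0 = 0 := by ext j; simp [a]
  have hemb : ∀ z h, torusEmb (z + a h) = fun j => torusEmb z j *
      Complex.exp (2 * Real.pi * Complex.I * ((Pi.single i 1 : Fin n → ℝ) j : ℝ) * h) := by
    intro z h
    ext j
    simp only [torusEmb, Pi.add_apply, fourier_add_right, a, fourier_coe_apply]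
    congr 2
    push_cast
    ring
  have hmf : ∀ h, UnitAddTorus.mFourier (-m) (a h)
      = Complex.exp (-(2 * Real.pi * Complex.I * m i * h)) := by
    intro h
    simp only [UnitAddTorus.mFourier, ContinuousMap.coe_mk]
    rw [Finset.prod_eq_single i]
    · simp only [a, fourier_coe_apply]
      congr 1
      simp
    · intro j _ hj
      simp [a, hj]
    · simp
  have hder : ∀ z h, HasDerivAt (fun h => UnitAddTorus.mFourier (-m) z * Φ (torusEmb (z + a h)))
      (UnitAddTorus.mFourier (-m) z * torusDeriv i Φ (torusEmb (z + a h))) h := by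
    intro z h
    refine HasDerivAt.const_mul _ ?_
    have h1 : HasDerivAt (fun h => torusEmb (z + a h)) (fun j => 2 * Real.pi * Complex.I *
        ((Pi.single i 1 : Fin n → ℝ) j : ℝ) * torusEmb (z + a h) j) h := by
      simp only [hemb]
      rw [hasDerivAt_pi]
      intro j
      have h2 : HasDerivAt (fun x : ℝ => 2 * Real.pi * Complex.I *
          (((Pi.single i 1 : Fin n → ℝ) j : ℝ) : ℂ) * (x : ℂ)) (2 * Real.pi * Complex.I *
          (((Pi.single i 1 : Fin n → ℝ) j : ℝ) : ℂ) * 1) h :=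
        (Complex.ofRealCLM.hasDerivAt (x := h)).const_mul _
      refine (h2.cexp.const_mul (torusEmb z j)).congr_deriv ?_
      ring
    exact ((hΦ.differentiable (by simp)).differentiableAt.hasFDerivAt (x := _)).comp_hasDerivAt h h1
  have hcd : Continuous fun z => torusDeriv i Φ (torusEmb z) :=
    (contDiff_torusDeriv i hΦ).continuous.comp continuous_torusEmb
  have hca : Continuous fun z => Φ (torusEmb z) := hΦ.continuous.comp continuous_torusEmb
  obtain ⟨C, hC⟩ := isCompact_univ.exists_bound_of_continuousOn hcd.continuousOn
  have key := (hasDerivAt_integral_of_dominated_loc_of_deriv_le (μ := torusMeasure n)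
    (F := fun h z => UnitAddTorus.mFourier (-m) z * Φ (torusEmb (z + a h)))
    (F' := fun h z => UnitAddTorus.mFourier (-m) z * torusDeriv i Φ (torusEmb (z + a h)))
    (x₀ := 0) (bound := fun _ => C) Filter.univ_mem
    (.of_forall fun h => (integrable_torus (((UnitAddTorus.mFourier (-m)).continuous).mul
      (hca.comp (continuous_id.add continuous_const)))).aestronglyMeasurable)
    (integrable_torus (((UnitAddTorus.mFourier (-m)).continuous).mul
      (hca.comp (continuous_id.add continuous_const))))
    (integrable_torus (((UnitAddTorus.mFourier (-m)).continuous).mul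
      (hcd.comp (continuous_id.add continuous_const)))).aestronglyMeasurable
    (.of_forall fun z h _ => by
      rw [norm_mul, norm_mFourier_apply, one_mul]
      exact hC _ (Set.mem_univ _))
    (integrable_const _) (.of_forall fun z h _ => hder z h)).2
  have hI : ∀ h : ℝ, ∫ z, UnitAddTorus.mFourier (-m) z * Φ (torusEmb (z + a h)) ∂torusMeasure n
      = Complex.exp (2 * Real.pi * Complex.I * m i * h) * torusCoeff Φ m := by
    intro h
    have h1 := integral_add_right_eq_self (μ := torusMeasure n)
      (fun z => UnitAddTorus.mFourier (-m) z * Φ (torusEmb z)) (a h)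
    rw [torusCoeff, ← h1, ← integral_const_mul]
    congr 1
    ext z
    rw [mFourier_add_right, hmf, Complex.exp_neg]
    have := Complex.exp_ne_zero (2 * Real.pi * Complex.I * m i * h)
    field_simp
  simp only [hI, ha0, add_zero] at key
  have h2 : HasDerivAt (fun h : ℝ => Complex.exp (2 * Real.pi * Complex.I * m i * h)
      * torusCoeff Φ m) (2 * Real.pi * Complex.I * m i * torusCoeff Φ m) 0 := by
    have h3 : HasDerivAt (fun x : ℝ => 2 * Real.pi * Complex.I * m i * (x : ℂ))
        (2 * Real.pi * Complex.I * m i * 1) 0 :=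
      (Complex.ofRealCLM.hasDerivAt (x := 0)).const_mul _
    refine (h3.cexp.mul_const (torusCoeff Φ m)).congr_deriv ?_
    simp
  exact key.unique h2

theorem norm_torusCoeff_le {n : ℕ} {Φ : (Fin n → ℂ) → ℂ} (hΦ : ContDiff ℝ ∞ Φ) :
    ∃ C : ℝ, ∀ m, ‖torusCoeff Φ m‖ ≤ C := by
  have hca : Continuous fun z => Φ (torusEmb z) := hΦ.continuous.comp continuous_torusEmb
  obtain ⟨C, hC⟩ := isCompact_univ.exists_bound_of_continuousOn hca.continuousOn
  refine ⟨C, fun m => ?_⟩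
  refine (norm_integral_le_of_norm_le_const (C := C) (.of_forall fun z => ?_)).trans (by simp)
  rw [norm_mul, norm_mFourier_apply, one_mul]
  exact hC _ (Set.mem_univ _)

/-- The degree of a multi-frequency. -/
def freqDeg {n : ℕ} (m : Fin n → ℤ) : ℕ := ∑ i, (m i).natAbs

theorem pow_mul_norm_torusCoeff_le {n : ℕ} (i : Fin n) (N : ℕ) :
    ∀ {Φ : (Fin n → ℂ) → ℂ}, ContDiff ℝ ∞ Φ →
      ∃ C : ℝ, ∀ m, (m i).natAbs ^ N * ‖torusCoeff Φ m‖ ≤ C := by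
  induction N with
  | zero => intro Φ hΦ; simpa using norm_torusCoeff_le hΦ
  | succ N ih =>
    intro Φ hΦ
    obtain ⟨C, hC⟩ := ih (contDiff_torusDeriv i hΦ)
    refine ⟨C, fun m => le_trans ?_ (hC m)⟩
    rw [torusCoeff_torusDeriv i hΦ, pow_succ, mul_assoc, norm_mul]
    gcongr
    have : ‖2 * (Real.pi : ℂ) * Complex.I * m i‖ = 2 * Real.pi * (m i).natAbs := by
      simp [abs_of_pos Real.pi_pos, Nat.cast_natAbs]
    rw [this]
    have : (0 : ℝ) ≤ (m i).natAbs := by positivity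
    nlinarith [Real.pi_gt_three]

/-- Rapid decay of Fourier coefficients of smooth functions on the torus. -/
theorem one_add_freqDeg_pow_mul_norm_torusCoeff_le {n : ℕ} (N : ℕ) {Φ : (Fin n → ℂ) → ℂ}
    (hΦ : ContDiff ℝ ∞ Φ) :
    ∃ C : ℝ, ∀ m, (1 + freqDeg m : ℝ) ^ N * ‖torusCoeff Φ m‖ ≤ C := by
  obtain ⟨C0, h0⟩ := norm_torusCoeff_le hΦ
  choose C hC using fun i => pow_mul_norm_torusCoeff_le (n := n) i N hΦ
  have h0' : 0 ≤ C0 := (norm_nonneg _).trans (h0 0)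
  have hC' : ∀ i, 0 ≤ C i := fun i => le_trans (by positivity) (hC i 0)
  refine ⟨(n + 1 : ℝ) ^ N * (C0 + ∑ i, C i), fun m => ?_⟩
  have hex : ∃ s : ℝ, 0 ≤ s ∧ s ^ N * ‖torusCoeff Φ m‖ ≤ C0 + ∑ i, C i ∧ 1 ≤ s ∧
      ∀ i, ((m i).natAbs : ℝ) ≤ s := by
    rcases Nat.eq_zero_or_pos n with hn | hn
    · subst hn
      exact ⟨1, zero_le_one, by simpa using h0 m, le_rfl, fun i => i.elim0⟩
    have : Nonempty (Fin n) := ⟨⟨0, hn⟩⟩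
    obtain ⟨i, hi⟩ := Finite.exists_max fun i => (m i).natAbs
    have hsum : C i ≤ ∑ i, C i := Finset.single_le_sum (fun j _ => hC' j) (Finset.mem_univ i)
    rcases Nat.eq_zero_or_pos (m i).natAbs with h | h
    · refine ⟨1, zero_le_one, ?_, le_rfl, fun j => ?_⟩
      · rw [one_pow, one_mul]
        linarith [h0 m, hC' i]
      · have := hi j
        exact_mod_cast (by omega : (m j).natAbs ≤ 1)
    · exact ⟨(m i).natAbs, by positivity, by linarith [hC i m], by exact_mod_cast h,
        fun j => by exact_mod_cast hi j⟩
  obtain ⟨s, hs0, hs, hs1, hsm⟩ := hex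
  have : (1 + freqDeg m : ℝ) ≤ (n + 1) * s := by
    have : (freqDeg m : ℝ) ≤ n * s := by
      simp only [freqDeg, Nat.cast_sum]
      refine (Finset.sum_le_sum fun i _ => hsm i).trans (by simp)
    linarith
  calc (1 + freqDeg m : ℝ) ^ N * ‖torusCoeff Φ m‖
      ≤ ((n + 1) * s) ^ N * ‖torusCoeff Φ m‖ := by gcongr
    _ = (n + 1 : ℝ) ^ N * (s ^ N * ‖torusCoeff Φ m‖) := by rw [mul_pow, mul_assoc]
    _ ≤ _ := by gcongr

theorem summable_prod_of_summable {n : ℕ} {g : ℤ → ℝ} (h0 : ∀ k, 0 ≤ g k) (hg : Summable g) :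
    Summable fun m : Fin n → ℤ => ∏ i, g (m i) := by
  induction n with
  | zero => exact Summable.of_finite
  | succ n ih =>
    rw [← (Fin.consEquiv fun _ : Fin (n + 1) => ℤ).summable_iff]
    have := hg.mul_of_nonneg ih h0 (fun m => Finset.prod_nonneg fun i _ => h0 _)
    refine this.congr fun x => ?_
    simp [Fin.prod_univ_succ]

theorem summable_inv_one_add_natAbs_sq : Summable fun k : ℤ => ((1 + k.natAbs : ℝ) ^ 2)⁻¹ := by
  have h : Summable fun k : ℕ => ((1 + k : ℝ) ^ 2)⁻¹ := by
    have := (summable_nat_add_iff 1).2 (Real.summable_nat_pow_inv.2 one_lt_two)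
    refine this.congr fun k => ?_
    push_cast
    rw [add_comm]
  exact Summable.of_nat_of_neg (by simpa using h) (by simpa using h)

/-- The series of negative powers of degrees converges. -/
theorem summable_one_add_freqDeg (n : ℕ) :
    Summable fun m : Fin n → ℤ => ((1 + freqDeg m : ℝ) ^ (2 * n))⁻¹ := by
  refine Summable.of_nonneg_of_le (fun m => by positivity) (fun m => ?_)
    (summable_prod_of_summable (n := n) (fun k => by positivity) summable_inv_one_add_natAbs_sq)
  rw [Finset.prod_inv_distrib]
  refine inv_anti₀ (Finset.prod_pos fun i _ => by positivity) ?_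
  calc ∏ i, (1 + (m i).natAbs : ℝ) ^ 2 ≤ ∏ _i : Fin n, (1 + freqDeg m : ℝ) ^ 2 := by
        refine Finset.prod_le_prod (fun i _ => by positivity) fun i _ => ?_
        gcongr
        exact Finset.single_le_sum (f := fun i => (m i).natAbs) (fun _ _ => Nat.zero_le _)
          (Finset.mem_univ i)
    _ = _ := by simp [pow_mul]

/-- Polynomially weighted Fourier coefficients of smooth functions are summable. -/
theorem summable_pow_mul_norm_torusCoeff {n : ℕ} (N : ℕ) {Φ : (Fin n → ℂ) → ℂ}
    (hΦ : ContDiff ℝ ∞ Φ) : Summable fun m => (1 + freqDeg m : ℝ) ^ N * ‖torusCoeff Φ m‖ := by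
  obtain ⟨C, hC⟩ := one_add_freqDeg_pow_mul_norm_torusCoeff_le (N + 2 * n) hΦ
  refine Summable.of_nonneg_of_le (fun m => by positivity) (fun m => ?_)
    ((summable_one_add_freqDeg n).mul_left C)
  have h := hC m
  rw [pow_add] at h
  rw [← div_eq_mul_inv, le_div_iff₀ (by positivity)]
  linarith

theorem hasSum_torusCoeff {n : ℕ} {Φ : (Fin n → ℂ) → ℂ} (hΦ : ContDiff ℝ ∞ Φ)
    (z : UnitAddTorus (Fin n)) :
    HasSum (fun m => torusCoeff Φ m * UnitAddTorus.mFourier m z) (Φ (torusEmb z)) := by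
  have h1 : Summable (UnitAddTorus.mFourierCoeff
      (⟨fun z => Φ (torusEmb z), hΦ.continuous.comp continuous_torusEmb⟩ :
        C(UnitAddTorus (Fin n), ℂ))) :=
    Summable.of_norm ((summable_pow_mul_norm_torusCoeff 0 hΦ).congr fun m => by
      rw [pow_zero, one_mul]
      rfl)
  exact UnitAddTorus.hasSum_mFourier_series_apply_of_summable h1 z

theorem HasSum.of_eq {ι : Type*} {f g : ι → ℂ} {a b : ℂ} (h : HasSum g b) (hf : ∀ i, f i = g i)
    (ha : a = b) : HasSum f a := by
  rw [ha, funext hf]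
  exact h

/-- The generating function of the Chebyshev polynomials. -/
def chebyshevKernel (w : ℂ) (t : ℝ) : ℂ := (1 - w * t) / (1 - 2 * w * t + w ^ 2)

theorem exp_mul_exp_neg_I (φ : ℝ) :
    Complex.exp (φ * Complex.I) * Complex.exp (-φ * Complex.I) = 1 := by
  rw [← Complex.exp_add]
  simp

theorem one_sub_two_mul_cos (w : ℂ) (φ : ℝ) :
    1 - 2 * w * Real.cos φ + w ^ 2 =
      (1 - w * Complex.exp (φ * Complex.I)) * (1 - w * Complex.exp (-φ * Complex.I)) := by
  have h := exp_mul_exp_neg_I φ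
  have h2 : (2 : ℂ) * Real.cos φ = Complex.exp (φ * Complex.I) + Complex.exp (-φ * Complex.I) := by
    rw [Complex.ofReal_cos, Complex.two_cos]
  linear_combination (-w) * h2 - w ^ 2 * h

theorem hasSum_chebyshevKernel {w : ℂ} (hw : ‖w‖ < 1) (φ : ℝ) :
    HasSum (fun k : ℕ => w ^ k * Real.cos (k * φ)) (chebyshevKernel w (Real.cos φ)) := by
  have hn : ∀ s : ℝ, ‖w * Complex.exp (s * Complex.I)‖ < 1 := fun s => by
    rwa [norm_mul, Complex.norm_exp_ofReal_mul_I, mul_one]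
  have h1 := hasSum_geometric_of_norm_lt_one (hn φ)
  have h2 := hasSum_geometric_of_norm_lt_one (hn (-φ))
  have hne : ∀ s : ℝ, 1 - w * Complex.exp (s * Complex.I) ≠ 0 := fun s h => by
    have := hn s
    rw [← sub_eq_zero.1 h] at this
    simp at this
  have h3 := (h1.add h2).mul_left (1 / 2)
  refine h3.of_eq (fun k => ?_) ?_
  · rw [Complex.ofReal_cos, Complex.cos, mul_pow, mul_pow, ← Complex.exp_nat_mul,
      ← Complex.exp_nat_mul]
    push_cast
    ring_nf
  · have h2 : (2 : ℂ) * Real.cos φ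
        = Complex.exp (φ * Complex.I) + Complex.exp (-φ * Complex.I) := by
      rw [Complex.ofReal_cos, Complex.two_cos]
    rw [chebyshevKernel, one_sub_two_mul_cos]
    have ha := hne φ
    have hb := hne (-φ)
    push_cast at hb ⊢
    rw [← Complex.ofReal_cos]
    generalize Complex.exp (φ * Complex.I) = a at *
    generalize Complex.exp (-φ * Complex.I) = b at *
    field_simp
    linear_combination (-w) * h2

theorem integral_fourier_mul_chebyshevKernel {r : ℝ} (hr0 : 0 ≤ r) (hr : r < 1) (φ : ℝ) (k : ℕ) :
    ∫ θ : UnitAddCircle, fourier (-k : ℤ) θ * chebyshevKernel (r * fourier 1 θ) (Real.cos φ)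
      ∂AddCircle.haarAddCircle = r ^ k * Real.cos (k * φ) := by
  have hs : ∀ θ : UnitAddCircle, HasSum (fun j : ℕ => fourier (-k : ℤ) θ *
      (((r : ℂ) ^ j * Real.cos (j * φ)) * fourier (j : ℤ) θ))
      (fourier (-k : ℤ) θ * chebyshevKernel (r * fourier 1 θ) (Real.cos φ)) := by
    intro θ
    refine HasSum.mul_left _ ?_
    have hw : ‖(r : ℂ) * fourier 1 θ‖ < 1 := by
      rw [fourier_apply, norm_mul, Circle.norm_coe, mul_one, Complex.norm_real,
        Real.norm_of_nonneg hr0]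
      exact hr
    refine (hasSum_chebyshevKernel hw φ).of_eq (fun j => ?_) rfl
    have : (fourier (j : ℤ) θ : ℂ) = fourier 1 θ ^ j := by
      simp [fourier_apply, AddCircle.toCircle_nsmul]
    rw [this]
    ring
  have hint : ∀ j : ℕ, ∫ θ : UnitAddCircle, fourier (-k : ℤ) θ *
      (((r : ℂ) ^ j * Real.cos (j * φ)) * fourier (j : ℤ) θ) ∂AddCircle.haarAddCircle
      = if j = k then (r : ℂ) ^ k * Real.cos (k * φ) else 0 := by
    intro j
    have h1 : ∫ θ : UnitAddCircle, fourier (-k : ℤ) θ * fourier (j : ℤ) θ ∂AddCircle.haarAddCircle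
        = (Pi.single (j : ℤ) 1 : ℤ → ℂ) k := by
      have := congrFun (fourierCoeff_fourier (T := 1) (j : ℤ)) k
      rw [← this]
      rfl
    have h2 : ∀ θ : UnitAddCircle, fourier (-k : ℤ) θ *
        (((r : ℂ) ^ j * Real.cos (j * φ)) * fourier (j : ℤ) θ) =
        ((r : ℂ) ^ j * Real.cos (j * φ)) * (fourier (-k : ℤ) θ * fourier (j : ℤ) θ) :=
      fun θ => by ring
    simp only [h2, integral_const_mul, h1]
    split_ifs with h
    · simp [h]
    · rw [Pi.single_eq_of_ne (by exact_mod_cast Ne.symm h), mul_zero]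
  have hcont : ∀ j : ℕ, Continuous fun θ : UnitAddCircle => (fourier (-k : ℤ) θ : ℂ) *
      (((r : ℂ) ^ j * Real.cos (j * φ)) * fourier (j : ℤ) θ) := fun j =>
    (fourier _).continuous.mul (continuous_const.mul (fourier _).continuous)
  have hnorm : ∀ (j : ℕ) (θ : UnitAddCircle), ‖(fourier (-k : ℤ) θ : ℂ) *
      (((r : ℂ) ^ j * Real.cos (j * φ)) * fourier (j : ℤ) θ)‖ ≤ r ^ j := by
    intro j θ
    simp only [fourier_apply, norm_mul, Circle.norm_coe, mul_one, one_mul, norm_pow,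
      Complex.norm_real, Real.norm_of_nonneg hr0]
    exact mul_le_of_le_one_right (by positivity) (Real.abs_cos_le_one _)
  have hi : ∀ j : ℕ, Integrable (fun θ : UnitAddCircle => (fourier (-k : ℤ) θ : ℂ) *
      (((r : ℂ) ^ j * Real.cos (j * φ)) * fourier (j : ℤ) θ)) AddCircle.haarAddCircle := fun j =>
    (hcont j).integrable_of_hasCompactSupport (.of_compactSpace _)
  have h := hasSum_integral_of_summable_integral_norm hi
    (Summable.of_nonneg_of_le (fun j => integral_nonneg fun _ => norm_nonneg _) (fun j => by
      have := integral_mono (μ := AddCircle.haarAddCircle) (hi j).norm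
        (integrable_const (r ^ j)) (hnorm j)
      simpa using this) (summable_geometric_of_lt_one hr0 hr))
  simp only [hint, fun θ => (hs θ).tsum_eq] at h
  exact h.unique (hasSum_ite_eq k _)

theorem integral_mFourier_mul_chebyshevKernel {n : ℕ} {r : ℝ} (hr0 : 0 ≤ r) (hr : r < 1)
    (φ : Fin n → ℝ) (k : Fin n → ℕ) :
    ∫ z, UnitAddTorus.mFourier (fun i => -(k i : ℤ)) z *
      ∏ i, chebyshevKernel (r * torusEmb z i) (Real.cos (φ i)) ∂torusMeasure n
      = r ^ (∑ i, k i) * ∏ i, (Real.cos (k i * φ i) : ℂ) := by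
  simp only [UnitAddTorus.mFourier, ContinuousMap.coe_mk, ← Finset.prod_mul_distrib, torusEmb,
    torusMeasure]
  rw [integral_fintype_prod_eq_prod (𝕜 := ℂ) (fun i (θ : UnitAddCircle) =>
    fourier (-(k i : ℤ)) θ * chebyshevKernel (r * fourier 1 θ) (Real.cos (φ i)))]
  simp only [integral_fourier_mul_chebyshevKernel hr0 hr, Finset.prod_mul_distrib,
    Finset.prod_pow_eq_pow_sum]

/-- Expansion in products of cosines of a smooth function of real parts. -/
theorem hasSum_torusCoeff_mul_cos {n : ℕ} {Φ : (Fin n → ℂ) → ℂ} (hΦ : ContDiff ℝ ∞ Φ)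
    (hre : ∀ u v, (∀ i, (u i).re = (v i).re) → Φ u = Φ v) (φ : Fin n → ℝ) :
    HasSum (fun m => torusCoeff Φ m * ∏ i, (Real.cos (m i * φ i) : ℂ))
      (Φ fun i => (Real.cos (φ i) : ℂ)) := by
  let z : (Fin n → Bool) → UnitAddTorus (Fin n) := fun ε i =>
    (((if ε i then φ i else -φ i) / (2 * Real.pi) : ℝ) : UnitAddCircle)
  have hf : ∀ (k : ℤ) (s : ℝ), (fourier k ((s / (2 * Real.pi) : ℝ) : UnitAddCircle) : ℂ)
      = Complex.exp (k * s * Complex.I) := by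
    intro k s
    rw [fourier_coe_apply]
    congr 1
    push_cast
    field_simp
  have hz : ∀ ε, Φ (torusEmb (z ε)) = Φ fun i => (Real.cos (φ i) : ℂ) := by
    intro ε
    refine hre _ _ fun i => ?_
    simp only [torusEmb, z, hf, Int.cast_one, one_mul, Complex.exp_ofReal_mul_I_re,
      Complex.ofReal_re]
    split_ifs <;> simp
  have h := (hasSum_sum fun ε (_ : ε ∈ (Finset.univ : Finset (Fin n → Bool))) =>
    hasSum_torusCoeff hΦ (z ε)).mul_left ((2 : ℂ) ^ n)⁻¹
  simp only [hz, Finset.sum_const, Finset.card_univ, ← Finset.mul_sum] at h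
  refine h.of_eq (fun m => ?_) ?_
  · rw [mul_left_comm]
    congr 1
    have hc : ∀ i, (Real.cos (m i * φ i) : ℂ) = 2⁻¹ * ∑ b : Bool,
        Complex.exp (m i * ((if b then φ i else -φ i : ℝ) : ℂ) * Complex.I) := by
      intro i
      rw [Complex.ofReal_cos, Complex.cos]
      simp
      ring
    simp only [hc, Finset.prod_mul_distrib, Finset.prod_const, Finset.card_univ, Fintype.card_fin,
      inv_pow, Finset.prod_univ_sum, Fintype.piFinset_univ]
    congr 1
    refine Finset.sum_congr rfl fun ε _ => ?_
    simp only [UnitAddTorus.mFourier, ContinuousMap.coe_mk, z, hf]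
  · simp

/-- Expansion in Chebyshev kernels of a smooth function of real parts. -/
theorem hasSum_torusCoeff_mul_integral {n : ℕ} {Φ : (Fin n → ℂ) → ℂ} (hΦ : ContDiff ℝ ∞ Φ)
    (hre : ∀ u v, (∀ i, (u i).re = (v i).re) → Φ u = Φ v) {r : (Fin n → ℤ) → ℝ}
    (hr0 : ∀ m, 0 < r m) (hr : ∀ m, r m < 1) {t : Fin n → ℝ} (ht : ∀ i, |t i| ≤ 1) :
    HasSum (fun m => torusCoeff Φ m * (((r m : ℂ) ^ freqDeg m)⁻¹ *
      ∫ z, UnitAddTorus.mFourier (fun i => -((m i).natAbs : ℤ)) z *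
        ∏ i, chebyshevKernel (r m * torusEmb z i) (t i) ∂torusMeasure n))
      (Φ fun i => (t i : ℂ)) := by
  have hcos : ∀ i, Real.cos (Real.arccos (t i)) = t i := fun i =>
    Real.cos_arccos (abs_le.1 (ht i)).1 (abs_le.1 (ht i)).2
  have h := hasSum_torusCoeff_mul_cos hΦ hre fun i => Real.arccos (t i)
  simp only [hcos] at h
  refine h.of_eq (fun m => ?_) rfl
  congr 1
  have h1 := integral_mFourier_mul_chebyshevKernel (hr0 m).le (hr m)
    (fun i => Real.arccos (t i)) fun i => (m i).natAbs
  simp only [hcos] at h1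
  have h2 : (r m : ℂ) ^ (∑ i, (m i).natAbs) ≠ 0 :=
    pow_ne_zero _ (by exact_mod_cast (hr0 m).ne')
  rw [h1, freqDeg, inv_mul_cancel_left₀ h2]
  refine Finset.prod_congr rfl fun i _ => ?_
  rcases Int.natAbs_eq (m i) with h3 | h3
  · congr 2
    nth_rewrite 2 [h3]
    simp
  · nth_rewrite 2 [h3]
    simp

section Invariants

variable {n l : ℕ} {G : Subgroup (Matrix.GeneralLinearGroup (Fin n) ℝ)}

/-- The linear action of an element of `G`. -/
def linAct (γ : G) (x : Fin n → ℝ) : Fin n → ℝ :=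
  ((γ : Matrix.GeneralLinearGroup (Fin n) ℝ) : Matrix (Fin n) (Fin n) ℝ).mulVec x

theorem linAct_mul (γ δ : G) (x : Fin n → ℝ) : linAct (γ * δ) x = linAct γ (linAct δ x) := by
  simp [linAct, Matrix.mulVec_mulVec]

/-- Sums over orbits of polynomials are polynomials in the generators of the invariants. -/
theorem exists_sum_linAct_eq_eval [Fintype G] {p : Fin l → MvPolynomial (Fin n) ℝ}
    (hgen : ∀ q : MvPolynomial (Fin n) ℝ, (∀ γ : G, ∀ x : Fin n → ℝ,
        MvPolynomial.eval (linAct γ x) q = MvPolynomial.eval x q) →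
        q ∈ Algebra.adjoin ℝ (Set.range p)) (q₀ : MvPolynomial (Fin n) ℝ) :
    ∃ q : MvPolynomial (Fin l) ℝ, ∀ x, ∑ γ : G, MvPolynomial.eval (linAct γ x) q₀
      = MvPolynomial.eval (fun j => MvPolynomial.eval x (p j)) q := by
  let q₁ : MvPolynomial (Fin n) ℝ := ∑ γ : G, MvPolynomial.bind₁
    (fun i => ∑ j, MvPolynomial.C (((γ : Matrix.GeneralLinearGroup (Fin n) ℝ) :
      Matrix (Fin n) (Fin n) ℝ) i j) * MvPolynomial.X j) q₀
  have h1 : ∀ x, MvPolynomial.eval x q₁ = ∑ γ : G, MvPolynomial.eval (linAct γ x) q₀ := by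
    intro x
    simp only [q₁, map_sum]
    refine Finset.sum_congr rfl fun γ _ => ?_
    rw [MvPolynomial.eval, MvPolynomial.eval₂Hom_bind₁]
    congr 2
    ext i
    simp [linAct, Matrix.mulVec, dotProduct]
  have h2 : q₁ ∈ Algebra.adjoin ℝ (Set.range p) := by
    refine hgen q₁ fun δ x => ?_
    rw [h1, h1]
    simp only [← linAct_mul]
    exact Equiv.sum_comp (Equiv.mulRight δ) fun γ => MvPolynomial.eval (linAct γ x) q₀
  rw [Algebra.adjoin_range_eq_range_aeval] at h2
  obtain ⟨q, hq⟩ := h2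
  refine ⟨q, fun x => ?_⟩
  rw [← h1, ← hq]
  change MvPolynomial.eval x (MvPolynomial.aeval p q) = _
  rw [MvPolynomial.aeval_eq_bind₁, MvPolynomial.eval, MvPolynomial.eval₂Hom_bind₁]
  rfl

theorem Function.HasTemperateGrowth.finset_prod {ι E : Type*} [NormedAddCommGroup E]
    [NormedSpace ℝ E] (s : Finset ι) {R : Type*} [NormedCommRing R] [NormedAlgebra ℝ R]
    {f : ι → E → R}
    (h : ∀ i, (f i).HasTemperateGrowth) :
    Function.HasTemperateGrowth fun x => ∏ i ∈ s, f i x := by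
  classical
  induction s using Finset.induction_on with
  | empty => simp
  | insert i s hi ih =>
    simp only [Finset.prod_insert hi]
    exact (h i).fun_mul ih

theorem hasTemperateGrowth_eval (q : MvPolynomial (Fin l) ℝ) :
    Function.HasTemperateGrowth fun y : Fin l → ℝ => MvPolynomial.eval y q := by
  induction q using MvPolynomial.induction_on with
  | C a => simp
  | add p q hp hq => simpa using hp.fun_add hq
  | mul_X p i hp =>
    simpa using hp.fun_mul (ContinuousLinearMap.proj (R := ℝ) (φ := fun _ : Fin l => ℝ)
      i).hasTemperateGrowth

theorem exists_hasTemperateGrowth_sum_linAct [Fintype G] {p : Fin l → MvPolynomial (Fin n) ℝ}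
    (hgen : ∀ q : MvPolynomial (Fin n) ℝ, (∀ γ : G, ∀ x : Fin n → ℝ,
        MvPolynomial.eval (linAct γ x) q = MvPolynomial.eval x q) →
        q ∈ Algebra.adjoin ℝ (Set.range p)) (Q : MvPolynomial (Fin n ⊕ Fin n) ℂ) :
    ∃ Qh : (Fin n → ℂ) × (Fin l → ℝ) → ℂ, Qh.HasTemperateGrowth ∧ ∀ w x,
      Qh (w, fun j => MvPolynomial.eval x (p j)) =
        ∑ γ : G, MvPolynomial.eval (Sum.elim w fun i => (linAct γ x i : ℂ)) Q := by
  induction Q using MvPolynomial.induction_on' with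
  | monomial u c =>
    obtain ⟨q, hq⟩ := exists_sum_linAct_eq_eval hgen
      (∏ i, (MvPolynomial.X i : MvPolynomial (Fin n) ℝ) ^ u (Sum.inr i))
    refine ⟨fun v => c * (∏ i, v.1 i ^ u (Sum.inl i)) * (MvPolynomial.eval v.2 q : ℝ), ?_, ?_⟩
    · refine ((Function.HasTemperateGrowth.const c).fun_mul
        (Function.HasTemperateGrowth.finset_prod _ fun i => ?_)).fun_mul ?_
      · exact (((ContinuousLinearMap.proj (R := ℝ) (φ := fun _ : Fin n => ℂ) i).comp
          (ContinuousLinearMap.fst ℝ (Fin n → ℂ) (Fin l → ℝ))).hasTemperateGrowth).fun_pow _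
      · exact Function.HasTemperateGrowth.comp (g := Complex.ofReal)
          Function.Complex.hasTemperateGrowth_ofReal ((hasTemperateGrowth_eval q).comp
          (ContinuousLinearMap.snd ℝ (Fin n → ℂ) (Fin l → ℝ)).hasTemperateGrowth)
    · intro w x
      beta_reduce
      rw [← hq]
      simp only [map_prod, map_pow, MvPolynomial.eval_X, MvPolynomial.eval_monomial]
      push_cast
      rw [Finset.mul_sum]
      refine Finset.sum_congr rfl fun γ _ => ?_
      rw [Finsupp.prod_fintype _ _ (fun _ => pow_zero _), Fintype.prod_sum_type]
      simp [mul_assoc]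
  | add P Q hP hQ =>
    obtain ⟨f, hf, hf'⟩ := hP
    obtain ⟨g, hg, hg'⟩ := hQ
    exact ⟨fun v => f v + g v, hf.fun_add hg, fun w x => by
      simp [hf', hg', Finset.sum_add_distrib]⟩

/-- The quadratic factor of the denominator of the Chebyshev kernel. -/
def chebyshevDenom (w : ℂ) (t : ℝ) : ℂ := 1 - 2 * w * t + w ^ 2

theorem sq_one_sub_norm_le_chebyshevDenom {w : ℂ} (hw : ‖w‖ ≤ 1) {t : ℝ} (ht : |t| ≤ 1) :
    (1 - ‖w‖) ^ 2 ≤ ‖chebyshevDenom w t‖ := by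
  rw [chebyshevDenom, ← Real.cos_arccos (abs_le.1 ht).1 (abs_le.1 ht).2, one_sub_two_mul_cos,
    norm_mul, sq]
  have h : ∀ s : ℝ, 1 - ‖w‖ ≤ ‖1 - w * Complex.exp (s * Complex.I)‖ := fun s => by
    have := norm_sub_norm_le 1 (w * Complex.exp (s * Complex.I))
    rwa [norm_one, norm_mul, Complex.norm_exp_ofReal_mul_I, mul_one] at this
  have h2 := h (-Real.arccos t)
  push_cast at h2
  exact mul_le_mul (h _) h2 (by linarith) (norm_nonneg _)

/-- The orbit sum of products of Chebyshev kernels is a quotient of two functions of the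
basic invariants, with a denominator bounded below. -/
theorem exists_sum_prod_chebyshevKernel_eq_div [Fintype G] {p : Fin l → MvPolynomial (Fin n) ℝ}
    (hgen : ∀ q : MvPolynomial (Fin n) ℝ, (∀ γ : G, ∀ x : Fin n → ℝ,
        MvPolynomial.eval (linAct γ x) q = MvPolynomial.eval x q) →
        q ∈ Algebra.adjoin ℝ (Set.range p)) (T : ℝ) :
    ∃ A D : (Fin n → ℂ) × (Fin l → ℝ) → ℂ, A.HasTemperateGrowth ∧ D.HasTemperateGrowth ∧
      ∀ (r : ℝ) (w : Fin n → ℂ) (x : Fin n → ℝ), r < 1 → (∀ i, ‖w i‖ = r) →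
        (∀ (γ : G) i, |linAct γ x i / T| ≤ 1) →
        (1 - r) ^ (2 * (n * Fintype.card G)) ≤ ‖D (w, fun j => MvPolynomial.eval x (p j))‖ ∧
        ∑ γ : G, ∏ i, chebyshevKernel (w i) (linAct γ x i / T) =
          A (w, fun j => MvPolynomial.eval x (p j)) /
            D (w, fun j => MvPolynomial.eval x (p j)) := by
  classical
  let d : G → Fin n → MvPolynomial (Fin n ⊕ Fin n) ℂ := fun γ i =>
    1 - 2 * MvPolynomial.X (Sum.inl i) * (MvPolynomial.C (T : ℂ)⁻¹ * ∑ j, MvPolynomial.C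
      ((((γ : Matrix.GeneralLinearGroup (Fin n) ℝ) : Matrix (Fin n) (Fin n) ℝ) i j : ℝ) : ℂ) *
      MvPolynomial.X (Sum.inr j)) + MvPolynomial.X (Sum.inl i) ^ 2
  have hd : ∀ γ i w (x : Fin n → ℝ), MvPolynomial.eval (Sum.elim w fun i => (x i : ℂ)) (d γ i)
      = chebyshevDenom (w i) (linAct γ x i / T) := by
    intro γ i w x
    simp [d, chebyshevDenom, linAct, Matrix.mulVec, dotProduct, div_eq_inv_mul]
  let a : Fin n → MvPolynomial (Fin n ⊕ Fin n) ℂ := fun i =>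
    1 - MvPolynomial.X (Sum.inl i) * (MvPolynomial.C (T : ℂ)⁻¹ * MvPolynomial.X (Sum.inr i))
  have ha : ∀ i w (x : Fin n → ℝ), MvPolynomial.eval (Sum.elim w fun i => (x i : ℂ)) (a i)
      = 1 - w i * (x i / T : ℝ) := by
    intro i w x
    simp [a, div_eq_inv_mul]
  obtain ⟨D₀, hD₀, hD⟩ := exists_hasTemperateGrowth_sum_linAct hgen (∏ γ, ∏ i, d γ i)
  obtain ⟨A, hA₀, hA⟩ := exists_hasTemperateGrowth_sum_linAct hgen
    ((∏ i, a i) * ∏ γ ∈ Finset.univ.erase (1 : G), ∏ i, d γ i)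
  have hcard : (Fintype.card G : ℂ) ≠ 0 := Nat.cast_ne_zero.2 Fintype.card_ne_zero
  refine ⟨A, fun v => (Fintype.card G : ℂ)⁻¹ * D₀ v, hA₀,
    (Function.HasTemperateGrowth.const _).fun_mul hD₀, fun r w x hr hw hx => ?_⟩
  simp only [map_prod, map_mul, hd, ha, ← linAct_mul] at hD hA
  have hDx : (Fintype.card G : ℂ)⁻¹ * D₀ (w, fun j => MvPolynomial.eval x (p j)) =
      ∏ γ : G, ∏ i, chebyshevDenom (w i) (linAct γ x i / T) := by
    rw [hD]
    have : ∀ δ : G, ∏ γ : G, ∏ i, chebyshevDenom (w i) (linAct (γ * δ) x i / T) =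
        ∏ γ : G, ∏ i, chebyshevDenom (w i) (linAct γ x i / T) := fun δ =>
      Equiv.prod_comp (Equiv.mulRight δ) fun γ => ∏ i, chebyshevDenom (w i) (linAct γ x i / T)
    simp only [this, Finset.sum_const, Finset.card_univ, nsmul_eq_mul]
    rw [inv_mul_cancel_left₀ hcard]
  have hle : ∀ (γ : G) i, (1 - r) ^ 2 ≤ ‖chebyshevDenom (w i) (linAct γ x i / T)‖ := fun γ i => by
    have := sq_one_sub_norm_le_chebyshevDenom ((hw i).trans_le hr.le) (hx γ i)
    rwa [hw i] at this
  have hne : ∀ (γ : G) i, chebyshevDenom (w i) (linAct γ x i / T) ≠ 0 := fun γ i h => by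
    have := hle γ i
    rw [h, norm_zero] at this
    have : 0 < (1 - r) ^ 2 := pow_pos (by linarith) 2
    linarith
  beta_reduce
  rw [hDx]
  constructor
  · simp only [norm_prod]
    calc (1 - r) ^ (2 * (n * Fintype.card G)) = ∏ _γ : G, ∏ _i : Fin n, (1 - r) ^ 2 := by
          simp [pow_mul]
      _ ≤ _ := Finset.prod_le_prod (fun _ _ => by positivity) fun γ _ =>
          Finset.prod_le_prod (fun _ _ => by positivity) fun i _ => hle γ i
  · rw [hA, Finset.sum_div]
    refine Finset.sum_congr rfl fun δ _ => ?_
    have h1 : ∏ γ : G, ∏ i, chebyshevDenom (w i) (linAct γ x i / T) =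
        (∏ i, chebyshevDenom (w i) (linAct δ x i / T)) * ∏ γ ∈ Finset.univ.erase (1 : G), ∏ i,
          chebyshevDenom (w i) (linAct (γ * δ) x i / T) := by
      rw [← Equiv.prod_comp (Equiv.mulRight δ) fun γ => ∏ i, chebyshevDenom (w i) (linAct γ x i / T),
        ← Finset.mul_prod_erase Finset.univ _ (Finset.mem_univ (1 : G))]
      simp
    have h2 : ∏ γ ∈ Finset.univ.erase (1 : G), ∏ i,
        chebyshevDenom (w i) (linAct (γ * δ) x i / T) ≠ 0 :=
      Finset.prod_ne_zero_iff.2 fun γ _ => Finset.prod_ne_zero_iff.2 fun i _ => hne _ _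
    rw [h1, mul_div_mul_right _ _ h2, ← Finset.prod_div_distrib]
    rfl

/-- Preimages of bounded sets under the basic invariants are bounded. -/
theorem exists_abs_linAct_le [Fintype G] {p : Fin l → MvPolynomial (Fin n) ℝ}
    (hgen : ∀ q : MvPolynomial (Fin n) ℝ, (∀ γ : G, ∀ x : Fin n → ℝ,
        MvPolynomial.eval (linAct γ x) q = MvPolynomial.eval x q) →
        q ∈ Algebra.adjoin ℝ (Set.range p)) {K : Set (Fin l → ℝ)} (hK : IsCompact K) :
    ∃ T : ℝ, 0 < T ∧ ∀ x, (fun j => MvPolynomial.eval x (p j)) ∈ K →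
      ∀ (γ : G) i, |linAct γ x i| ≤ T := by
  obtain ⟨q, hq⟩ := exists_sum_linAct_eq_eval hgen (∑ i, MvPolynomial.X i ^ 2)
  obtain ⟨C, hC⟩ := hK.exists_bound_of_continuousOn (MvPolynomial.continuous_eval q).continuousOn
  refine ⟨1 + |C|, by positivity, fun x hx γ i => ?_⟩
  have h1 := hC _ hx
  rw [← hq] at h1
  simp only [map_sum, map_pow, MvPolynomial.eval_X] at h1
  have h2 : linAct γ x i ^ 2 ≤ ∑ γ : G, ∑ i, linAct γ x i ^ 2 :=
    (Finset.single_le_sum (f := fun i => linAct γ x i ^ 2) (fun _ _ => sq_nonneg _)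
      (Finset.mem_univ i)).trans
    (Finset.single_le_sum (f := fun γ : G => ∑ i, linAct γ x i ^ 2)
      (fun _ _ => Finset.sum_nonneg fun _ _ => sq_nonneg _) (Finset.mem_univ γ))
  refine abs_le_of_sq_le_sq ?_ (by positivity)
  nlinarith [le_abs_self C, le_abs_self (∑ γ : G, ∑ i, linAct γ x i ^ 2), abs_nonneg C,
    Real.norm_eq_abs (∑ γ : G, ∑ i, linAct γ x i ^ 2)]

end Invariants

section Parameters

variable {E V : Type*} [NormedAddCommGroup E] [NormedSpace ℝ E] [NormedAddCommGroup V]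
  [NormedSpace ℝ V]

theorem iteratedFDeriv_prodMk_right {H : E × V → ℂ} (hH : ContDiff ℝ ∞ H) (k : ℕ) (e : E) (v : V) :
    iteratedFDeriv ℝ k (fun v => H (e, v)) v =
      (iteratedFDeriv ℝ k H (e, v)).compContinuousLinearMap
        fun _ => ContinuousLinearMap.inr ℝ E V := by
  have h1 : (fun v => H (e, v)) =
      (fun u => H (u + (e, 0))) ∘ ContinuousLinearMap.inr ℝ E V := by
    ext v
    simp
  have h2 : ContDiff ℝ ∞ fun u : E × V => H (u + (e, 0)) :=
    hH.comp (contDiff_id.add contDiff_const)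
  rw [h1, (ContinuousLinearMap.inr ℝ E V).iteratedFDeriv_comp_right h2 v
    (by exact_mod_cast le_top), iteratedFDeriv_comp_add_right]
  simp

theorem continuous_iteratedFDeriv_prodMk_right {H : E × V → ℂ} (hH : ContDiff ℝ ∞ H) (k : ℕ)
    (v : V) : Continuous fun e => iteratedFDeriv ℝ k (fun v => H (e, v)) v := by
  simp only [iteratedFDeriv_prodMk_right hH]
  exact (ContinuousMultilinearMap.compContinuousLinearMapL (𝕜 := ℝ) (F := ℂ)
    fun _ : Fin k => ContinuousLinearMap.inr ℝ E V).continuous.comp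
    ((hH.continuous_iteratedFDeriv (m := k) (by exact_mod_cast le_top)).comp (by fun_prop))

/-- Uniform bounds for partial derivatives of a function of temperate growth, with bounded
support in the second variable. -/
theorem exists_norm_iteratedFDeriv_prodMk_right_le {H : E × V → ℂ} (hH : H.HasTemperateGrowth)
    {R : ℝ} (hR0 : 0 ≤ R) (hR : ∀ e v, R < ‖v‖ → H (e, v) = 0) (k : ℕ) :
    ∃ (K : ℕ) (C : ℝ), 0 ≤ C ∧ ∀ e v,
      ‖iteratedFDeriv ℝ k (fun v => H (e, v)) v‖ ≤ C * (1 + ‖e‖) ^ K := by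
  obtain ⟨K, C, hC0, hC⟩ := hH.norm_iteratedFDeriv_le_uniform k
  refine ⟨K, C * (1 + R) ^ K, by positivity, fun e v => ?_⟩
  rcases lt_or_ge R ‖v‖ with hv | hv
  · have : (fun v => H (e, v)) =ᶠ[𝓝 v] fun _ => 0 :=
      Filter.eventually_of_mem ((isOpen_lt continuous_const continuous_norm).mem_nhds hv)
        fun u hu => hR e u hu
    rw [(this.iteratedFDeriv ℝ k).eq_of_nhds]
    have h0 : iteratedFDeriv ℝ k (fun _ : V => (0 : ℂ)) v = 0 := by simp
    rw [h0, norm_zero]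
    positivity
  · rw [iteratedFDeriv_prodMk_right hH.1]
    refine (ContinuousMultilinearMap.norm_compContinuousLinearMap_le _ _).trans ?_
    have h1 : ∏ _i : Fin k, ‖ContinuousLinearMap.inr ℝ E V‖ ≤ 1 :=
      Finset.prod_le_one (fun _ _ => norm_nonneg _) fun _ _ =>
        ContinuousLinearMap.norm_inr_le_one ℝ E V
    refine (mul_le_of_le_one_right (norm_nonneg _) h1).trans ((hC k le_rfl _).trans ?_)
    rw [mul_assoc, ← mul_pow]
    have h2 : ‖(e, v)‖ ≤ ‖e‖ + R :=
      max_le (by linarith [norm_nonneg e]) (by linarith [norm_nonneg e])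
    have h3 : 1 + ‖(e, v)‖ ≤ (1 + R) * (1 + ‖e‖) := by
      nlinarith [mul_nonneg hR0 (norm_nonneg e)]
    gcongr

theorem norm_smul_torusEmb_le {n : ℕ} {r : ℝ} (hr0 : 0 ≤ r) (hr : r ≤ 1)
    (z : UnitAddTorus (Fin n)) : ‖fun i => (r : ℂ) * torusEmb z i‖ ≤ 1 := by
  refine (pi_norm_le_iff_of_nonneg zero_le_one).2 fun i => ?_
  rw [norm_mul, torusEmb, fourier_apply, Circle.norm_coe, mul_one, Complex.norm_real,
    Real.norm_of_nonneg hr0]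
  exact hr

/-- A series of torus integrals with rapidly decaying coefficients is smooth. -/
theorem contDiff_tsum_torus_integral {n : ℕ} {H : (ℝ × (Fin n → ℂ)) × V → ℂ}
    (hH : H.HasTemperateGrowth) {R : ℝ} (hR0 : 0 ≤ R) (hR : ∀ e v, R < ‖v‖ → H (e, v) = 0)
    {c b : (Fin n → ℤ) → ℂ} (hc : ∀ N : ℕ, Summable fun m => (1 + freqDeg m : ℝ) ^ N * ‖c m‖)
    {N₀ N₁ : ℕ} (hb : ∀ m, ‖b m‖ ≤ (freqDeg m + 2 : ℝ) ^ N₁) {s r : (Fin n → ℤ) → ℝ}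
    (hs : ∀ m, |s m| ≤ (freqDeg m + 2 : ℝ) ^ N₀) (hr0 : ∀ m, 0 ≤ r m) (hr : ∀ m, r m ≤ 1)
    (k : (Fin n → ℤ) → (Fin n → ℤ)) :
    ContDiff ℝ ∞ fun y => ∑' m, c m * (b m * ∫ z, UnitAddTorus.mFourier (k m) z *
      H ((s m, fun i => r m * torusEmb z i), y) ∂torusMeasure n) := by
  choose K C hC0 hC using exists_norm_iteratedFDeriv_prodMk_right_le hH hR0 hR
  have hsec : ∀ e, ContDiff ℝ ∞ fun y => H (e, y) := fun e => hH.1.comp (by fun_prop)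
  have hsm : ∀ (m : Fin n → ℤ) (j : ℕ) (z : UnitAddTorus (Fin n)) (y : V),
      iteratedFDeriv ℝ j (fun y => UnitAddTorus.mFourier (k m) z *
        H ((s m, fun i => r m * torusEmb z i), y)) y = UnitAddTorus.mFourier (k m) z •
        iteratedFDeriv ℝ j (fun y => H ((s m, fun i => r m * torusEmb z i), y)) y :=
    fun m j z y => iteratedFDeriv_const_smul_apply
      (f := fun y => H ((s m, fun i => r m * torusEmb z i), y))
      (a := UnitAddTorus.mFourier (k m) z) (((hsec _).of_le (by exact_mod_cast le_top)).contDiffAt)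
  have hq : ∀ m : Fin n → ℤ, (1 : ℝ) ≤ freqDeg m + 2 := fun m => by
    have : (0 : ℝ) ≤ freqDeg m := by positivity
    linarith
  have hbd : ∀ m j z y, ‖iteratedFDeriv ℝ j (fun y => UnitAddTorus.mFourier (k m) z *
      H ((s m, fun i => r m * torusEmb z i), y)) y‖
      ≤ C j * (2 * (freqDeg m + 2 : ℝ) ^ N₀) ^ K j := by
    intro m j z y
    rw [hsm, norm_smul, norm_mFourier_apply, one_mul]
    refine (hC j _ y).trans ?_
    have h1 : 1 ≤ (freqDeg m + 2 : ℝ) ^ N₀ := one_le_pow₀ (hq m)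
    have h2 : ‖((s m, fun i => r m * torusEmb z i) : ℝ × (Fin n → ℂ))‖
        ≤ (freqDeg m + 2 : ℝ) ^ N₀ :=
      max_le (hs m) ((norm_smul_torusEmb_le (hr0 m) (hr m) z).trans h1)
    have := hC0 j
    gcongr
    linarith
  have hI : ∀ m, _ := fun m => contDiff_integral_of_bounded (μ := torusMeasure n)
    (G := fun z y => UnitAddTorus.mFourier (k m) z * H ((s m, fun i => r m * torusEmb z i), y))
    (fun z => contDiff_const.mul (hsec _)) (fun j y => by
      simp only [hsm]
      have hcont : Continuous fun z : UnitAddTorus (Fin n) => UnitAddTorus.mFourier (k m) z •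
          iteratedFDeriv ℝ j (fun y => H ((s m, fun i => r m * torusEmb z i), y)) y := by
        refine (UnitAddTorus.mFourier (k m)).continuous.smul
          ((continuous_iteratedFDeriv_prodMk_right hH.1 j y).comp ?_)
        exact continuous_const.prodMk (continuous_pi fun i =>
          continuous_const.mul ((continuous_apply i).comp continuous_torusEmb))
      exact hcont.aestronglyMeasurable_of_compactSpace) (hbd m)
  let v : ℕ → (Fin n → ℤ) → ℝ := fun j m => C j * 2 ^ K j * 2 ^ (N₁ + N₀ * K j) *
    ((1 + freqDeg m : ℝ) ^ (N₁ + N₀ * K j) * ‖c m‖)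
  refine contDiff_tsum (v := v) (fun m => ?_) (fun j _ => (hc _).mul_left _) fun j m y _ => ?_
  · exact contDiff_const.mul (contDiff_const.mul (hI m).1)
  · have h1 : iteratedFDeriv ℝ j (fun y => c m * (b m * ∫ z, UnitAddTorus.mFourier (k m) z *
        H ((s m, fun i => r m * torusEmb z i), y) ∂torusMeasure n)) y = (c m * b m) •
        iteratedFDeriv ℝ j (fun y => ∫ z, UnitAddTorus.mFourier (k m) z *
        H ((s m, fun i => r m * torusEmb z i), y) ∂torusMeasure n) y := by
      simp only [← mul_assoc (c m)]
      exact iteratedFDeriv_const_smul_apply (a := c m * b m)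
        (f := fun y => ∫ z, UnitAddTorus.mFourier (k m) z *
          H ((s m, fun i => r m * torusEmb z i), y) ∂torusMeasure n)
        (((hI m).1.of_le (by exact_mod_cast le_top)).contDiffAt)
    rw [h1, norm_smul, norm_mul]
    have h2 := (hI m).2 j y
    have h3 : (freqDeg m + 2 : ℝ) ≤ 2 * (1 + freqDeg m) := by
      have : (0 : ℝ) ≤ freqDeg m := by positivity
      linarith
    have := hC0 j
    calc ‖c m‖ * ‖b m‖ * _
        ≤ ‖c m‖ * (freqDeg m + 2 : ℝ) ^ N₁ * (C j * (2 * (freqDeg m + 2 : ℝ) ^ N₀) ^ K j) := by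
          gcongr
          exact hb m
      _ = C j * 2 ^ K j * ((freqDeg m + 2 : ℝ) ^ (N₁ + N₀ * K j)) * ‖c m‖ := by
          rw [mul_pow, ← pow_mul, pow_add]
          ring
      _ ≤ C j * 2 ^ K j * ((2 * (1 + freqDeg m : ℝ)) ^ (N₁ + N₀ * K j)) * ‖c m‖ := by
          gcongr
      _ = v j m := by
          simp only [v, mul_pow]
          ring

end Parameters

theorem inv_pow_freqDeg_le (M : ℕ) :
    (((M + 1 : ℝ) / (M + 2)) ^ M)⁻¹ ≤ M + 2 := by
  have h0 : (0 : ℝ) ≤ M := by positivity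
  have h1 := one_add_mul_le_pow (a := -(1 / (M + 2 : ℝ))) (by
    rw [neg_le_neg_iff, div_le_iff₀ (by positivity)]
    linarith) M
  have h2 : 1 + -(1 / (M + 2 : ℝ)) = (M + 1 : ℝ) / (M + 2) := by
    field_simp
    ring
  have h3 : 1 + (M : ℝ) * -(1 / (M + 2 : ℝ)) = 2 / (M + 2) := by
    field_simp
    ring
  rw [h2, h3] at h1
  rw [inv_le_comm₀ (by positivity) (by positivity)]
  refine le_trans ?_ h1
  rw [inv_eq_one_div]
  gcongr
  norm_num

theorem continuous_chebyshevKernel_torusEmb {n : ℕ} {r t : ℝ} (hr0 : 0 ≤ r) (hr : r < 1)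
    (ht : |t| ≤ 1) (i : Fin n) :
    Continuous fun z : UnitAddTorus (Fin n) => chebyshevKernel (r * torusEmb z i) t := by
  have h1 : Continuous fun z : UnitAddTorus (Fin n) => torusEmb z i :=
    (continuous_apply i).comp continuous_torusEmb
  refine Continuous.div (by fun_prop) (by fun_prop) fun z hz => ?_
  have hn : ‖(r : ℂ) * torusEmb z i‖ = r := by
    rw [norm_mul, torusEmb, fourier_apply, Circle.norm_coe, mul_one, Complex.norm_real,
      Real.norm_of_nonneg hr0]
  have h2 := sq_one_sub_norm_le_chebyshevDenom (hn.trans_le hr.le) ht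
  rw [hn, chebyshevDenom, hz, norm_zero] at h2
  have : 0 < (1 - r) ^ 2 := pow_pos (by linarith) 2
  linarith

/-- A smooth invariant function is, over a ball, a smooth function of the basic invariants. -/
theorem exists_contDiff_comp_eq_on_closedBall {n l : ℕ}
    {G : Subgroup (Matrix.GeneralLinearGroup (Fin n) ℝ)} [Finite G]
    {p : Fin l → MvPolynomial (Fin n) ℝ}
    (hgen : ∀ q : MvPolynomial (Fin n) ℝ, (∀ γ : G, ∀ x : Fin n → ℝ,
        MvPolynomial.eval (linAct γ x) q = MvPolynomial.eval x q) →
        q ∈ Algebra.adjoin ℝ (Set.range p))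
    {f : (Fin n → ℝ) → ℝ} (hf : ContDiff ℝ ∞ f) (hfG : ∀ (γ : G) x, f (linAct γ x) = f x)
    (y₀ : Fin l → ℝ) :
    ∃ F : (Fin l → ℝ) → ℝ, ContDiff ℝ ∞ F ∧ ∀ x,
      (fun j => MvPolynomial.eval x (p j)) ∈ Metric.closedBall y₀ 1 →
        F (fun j => MvPolynomial.eval x (p j)) = f x := by
  have := Fintype.ofFinite G
  obtain ⟨T, hT, hTx⟩ := exists_abs_linAct_le hgen (isCompact_closedBall y₀ 1)
  obtain ⟨A, D, hA, hD, hAD⟩ := exists_sum_prod_chebyshevKernel_eq_div hgen T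
  obtain ⟨κ, hκ, hκ1⟩ := exists_hasTemperateGrowth_eq_inv
  let χ : ContDiffBump y₀ := ⟨1, 2, one_pos, one_lt_two⟩
  let H : (ℝ × (Fin n → ℂ)) × (Fin l → ℝ) → ℂ := fun u =>
    ((χ u.2 : ℝ) : ℂ) * A (u.1.2, u.2) * κ ((u.1.1 : ℝ) * D (u.1.2, u.2))
  have hpair : Function.HasTemperateGrowth
      fun u : (ℝ × (Fin n → ℂ)) × (Fin l → ℝ) => (u.1.2, u.2) :=
    (((ContinuousLinearMap.snd ℝ ℝ (Fin n → ℂ)).comp (ContinuousLinearMap.fst ℝ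
      (ℝ × (Fin n → ℂ)) (Fin l → ℝ))).prod (ContinuousLinearMap.snd ℝ _ _)).hasTemperateGrowth
  have hH : H.HasTemperateGrowth := by
    refine (Function.HasTemperateGrowth.fun_mul ?_ (hA.comp hpair)).fun_mul
      (hκ.comp (Function.HasTemperateGrowth.fun_mul ?_ (hD.comp hpair)))
    · exact Function.HasTemperateGrowth.comp (g := Complex.ofReal)
        Function.Complex.hasTemperateGrowth_ofReal
        ((χ.hasCompactSupport.hasTemperateGrowth χ.contDiff).comp
          (ContinuousLinearMap.snd ℝ (ℝ × (Fin n → ℂ)) (Fin l → ℝ)).hasTemperateGrowth)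
    · exact Function.HasTemperateGrowth.comp (g := Complex.ofReal)
        Function.Complex.hasTemperateGrowth_ofReal
        ((ContinuousLinearMap.fst ℝ ℝ (Fin n → ℂ)).comp (ContinuousLinearMap.fst ℝ
          (ℝ × (Fin n → ℂ)) (Fin l → ℝ))).hasTemperateGrowth
  have hR : ∀ e v, ‖y₀‖ + 2 < ‖v‖ → H (e, v) = 0 := by
    intro e v hv
    have : χ v = 0 := χ.zero_of_le_dist (by
      rw [dist_eq_norm]
      change (2 : ℝ) ≤ _
      linarith [norm_sub_norm_le v y₀])
    simp [H, this]
  let Φ : (Fin n → ℂ) → ℂ := fun u => (f fun i => T * (u i).re : ℝ)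
  have hΦ : ContDiff ℝ ∞ Φ :=
    Complex.ofRealCLM.contDiff.comp (hf.comp (contDiff_pi.2 fun i =>
      contDiff_const.mul (Complex.reCLM.contDiff.comp (contDiff_apply ℝ ℂ i))))
  have hΦre : ∀ u v : Fin n → ℂ, (∀ i, (u i).re = (v i).re) → Φ u = Φ v := by
    intro u v h
    simp only [Φ, h]
  let r : (Fin n → ℤ) → ℝ := fun m => (freqDeg m + 1 : ℝ) / (freqDeg m + 2)
  have hr0 : ∀ m, 0 < r m := fun m => by positivity
  have hr1 : ∀ m, 1 - r m = (freqDeg m + 2 : ℝ)⁻¹ := fun m => by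
    simp only [r]
    field_simp
    ring
  have hr : ∀ m, r m < 1 := fun m => by
    have : 0 < 1 - r m := by rw [hr1]; positivity
    linarith
  let N := 2 * (n * Fintype.card G)
  let s : (Fin n → ℤ) → ℝ := fun m => (freqDeg m + 2 : ℝ) ^ N
  have hs0 : ∀ m, 0 < s m := fun m => by positivity
  let b : (Fin n → ℤ) → ℂ := fun m => ((r m : ℂ) ^ freqDeg m)⁻¹ * s m
  have hb : ∀ m, ‖b m‖ ≤ (freqDeg m + 2 : ℝ) ^ (1 + N) := by
    intro m
    rw [norm_mul, norm_inv, norm_pow, Complex.norm_real, Complex.norm_real,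
      Real.norm_of_nonneg (hr0 m).le, Real.norm_of_nonneg (hs0 m).le, pow_add, pow_one]
    have := hs0 m
    exact mul_le_mul_of_nonneg_right (inv_pow_freqDeg_le (freqDeg m)) (hs0 m).le
  have hsmooth := contDiff_tsum_torus_integral hH (by positivity) hR
    (fun N => summable_pow_mul_norm_torusCoeff N hΦ) hb
    (s := s) (N₀ := N) (fun m => (abs_of_pos (hs0 m)).le) (fun m => (hr0 m).le)
    (fun m => (hr m).le) fun m i => -((m i).natAbs : ℤ)
  refine ⟨_, Complex.reCLM.contDiff.comp ((contDiff_const (c := (Fintype.card G : ℂ)⁻¹)).mul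
    hsmooth), fun x hx => ?_⟩
  have ht : ∀ (γ : G) i, |linAct γ x i / T| ≤ 1 := fun γ i => by
    rw [abs_div, abs_of_pos hT, div_le_one hT]
    exact hTx x hx γ i
  have hsum := hasSum_sum fun (γ : G) (_ : γ ∈ Finset.univ) =>
    hasSum_torusCoeff_mul_integral hΦ hΦre hr0 hr (ht γ)
  have hval : ∀ γ : G, (Φ fun i => ((linAct γ x i / T : ℝ) : ℂ)) = f x := fun γ => by
    rw [← hfG γ x]
    simp only [Φ, Complex.ofReal_re, mul_div_cancel₀ _ hT.ne']
  simp only [hval, Finset.sum_const, Finset.card_univ, nsmul_eq_mul, ← Finset.mul_sum] at hsum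
  have hterm : ∀ m, ∑ γ : G, ∫ z, UnitAddTorus.mFourier (fun i => -((m i).natAbs : ℤ)) z *
      ∏ i, chebyshevKernel (r m * torusEmb z i) (linAct γ x i / T) ∂torusMeasure n =
      s m * ∫ z, UnitAddTorus.mFourier (fun i => -((m i).natAbs : ℤ)) z *
        H ((s m, fun i => r m * torusEmb z i), fun j => MvPolynomial.eval x (p j))
        ∂torusMeasure n := by
    intro m
    have hint : ∀ γ : G, Integrable (fun z => UnitAddTorus.mFourier
        (fun i => -((m i).natAbs : ℤ)) z *
        ∏ i, chebyshevKernel (r m * torusEmb z i) (linAct γ x i / T)) (torusMeasure n) :=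
      fun γ => integrable_torus ((UnitAddTorus.mFourier _).continuous.mul
        (continuous_finsetProd _ fun i _ =>
          continuous_chebyshevKernel_torusEmb (hr0 m).le (hr m) (ht γ i) i))
    rw [← integral_finsetSum _ fun γ _ => hint γ, ← integral_const_mul]
    congr 1
    ext z
    have hw : ∀ i, ‖(r m : ℂ) * torusEmb z i‖ = r m := fun i => by
      rw [norm_mul, torusEmb, fourier_apply, Circle.norm_coe, mul_one, Complex.norm_real,
        Real.norm_of_nonneg (hr0 m).le]
    obtain ⟨h1, h2⟩ := hAD (r m) (fun i => r m * torusEmb z i) x (hr m) hw ht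
    rw [← Finset.mul_sum, h2]
    have hχ : χ (fun j => MvPolynomial.eval x (p j)) = 1 := χ.one_of_mem_closedBall hx
    have hsc : (s m : ℂ) ≠ 0 := by exact_mod_cast (hs0 m).ne'
    have h3 : 1 ≤ ‖(s m : ℂ) * D (fun i => r m * torusEmb z i,
        fun j => MvPolynomial.eval x (p j))‖ := by
      rw [hr1] at h1
      rw [norm_mul, Complex.norm_real, Real.norm_of_nonneg (hs0 m).le]
      calc (1 : ℝ) = s m * ((freqDeg m + 2 : ℝ)⁻¹) ^ N := by
            simp only [s]
            rw [inv_pow, mul_inv_cancel₀ (by positivity)]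
        _ ≤ _ := mul_le_mul_of_nonneg_left h1 (hs0 m).le
    simp only [H, hχ, hκ1 _ h3, Complex.ofReal_one, one_mul, mul_inv]
    field_simp
  simp only [hterm] at hsum
  have htot : ∑' m, torusCoeff Φ m * (b m * ∫ z,
      UnitAddTorus.mFourier (fun i => -((m i).natAbs : ℤ)) z *
        H ((s m, fun i => r m * torusEmb z i), fun j => MvPolynomial.eval x (p j))
        ∂torusMeasure n) = Fintype.card G * f x := by
    rw [← hsum.tsum_eq]
    simp only [b, mul_assoc]
  change ((Fintype.card G : ℂ)⁻¹ * ∑' m, _).re = f x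
  rw [htot, inv_mul_cancel_left₀ (Nat.cast_ne_zero.2 Fintype.card_ne_zero), Complex.ofReal_re]

/-- A smooth invariant function is a smooth function of the basic invariants. -/
theorem exists_contDiff_comp_eq {n l : ℕ}
    {G : Subgroup (Matrix.GeneralLinearGroup (Fin n) ℝ)} [Finite G]
    {p : Fin l → MvPolynomial (Fin n) ℝ}
    (hgen : ∀ q : MvPolynomial (Fin n) ℝ, (∀ γ : G, ∀ x : Fin n → ℝ,
        MvPolynomial.eval (linAct γ x) q = MvPolynomial.eval x q) →
        q ∈ Algebra.adjoin ℝ (Set.range p))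
    {f : (Fin n → ℝ) → ℝ} (hf : ContDiff ℝ ∞ f) (hfG : ∀ (γ : G) x, f (linAct γ x) = f x) :
    ∃ F : (Fin l → ℝ) → ℝ, ContDiff ℝ ∞ F ∧ ∀ x,
      f x = F fun j => MvPolynomial.eval x (p j) := by
  obtain ⟨g, hg⟩ := exists_contMDiffMap_forall_mem_convex_of_local
    (I := modelWithCornersSelf ℝ (Fin l → ℝ)) (M := Fin l → ℝ) (F := ℝ) (n := (⊤ : ℕ∞))
    (t := fun y => {v | ∀ x, (fun j => MvPolynomial.eval x (p j)) = y → v = f x})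
    (fun y u hu v hv a b _ _ hab x hx => by
      rw [hu x hx, hv x hx, ← add_smul, hab, one_smul])
    (fun y₀ => by
      obtain ⟨F, hF, hFx⟩ := exists_contDiff_comp_eq_on_closedBall hgen hf hfG y₀
      refine ⟨Metric.closedBall y₀ 1, Metric.closedBall_mem_nhds y₀ one_pos, F,
        hF.contMDiff.contMDiffOn, fun y hy x hx => ?_⟩
      subst hx
      exact hFx x hy)
  exact ⟨g, g.contMDiff.contDiff, fun x => (hg _ x rfl).symm⟩

end Schwarz

/-- G. Schwarz's theorem (for polynomial generators of the invariant algebra): if `G` is a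
finite subgroup of `GL(n,ℝ)` and `p 0, …, p (l-1)` are `G`-invariant polynomials generating
the `ℝ`-algebra `ℝ[x_1,…,x_n]^G` of `G`-invariant polynomials, then a smooth function
`f ∈ C^∞(ℝ^n)` is `G`-invariant if and only if it is a smooth function of `p 0, …, p (l-1)`. -/
theorem invariant_smooth_functions_generated (n l : ℕ)
    (G : Subgroup (Matrix.GeneralLinearGroup (Fin n) ℝ)) [Finite G]
    (p : Fin l → MvPolynomial (Fin n) ℝ)
    (hinv : ∀ j : Fin l, ∀ γ ∈ G, ∀ x : Fin n → ℝ,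
        MvPolynomial.eval ((γ : Matrix (Fin n) (Fin n) ℝ).mulVec x) (p j)
          = MvPolynomial.eval x (p j))
    (hgen : ∀ q : MvPolynomial (Fin n) ℝ,
        (∀ γ ∈ G, ∀ x : Fin n → ℝ,
            MvPolynomial.eval ((γ : Matrix (Fin n) (Fin n) ℝ).mulVec x) q
              = MvPolynomial.eval x q) →
        q ∈ Algebra.adjoin ℝ (Set.range p))
    (f : SmoothAlg n) :
    (∀ γ ∈ G, ∀ x : Fin n → ℝ,
        (f : (Fin n → ℝ) → ℝ) ((γ : Matrix (Fin n) (Fin n) ℝ).mulVec x)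
          = (f : (Fin n → ℝ) → ℝ) x) ↔
      ∃ F : SmoothAlg l, ∀ x : Fin n → ℝ,
        (f : (Fin n → ℝ) → ℝ) x
          = (F : (Fin l → ℝ) → ℝ) (fun j => MvPolynomial.eval x (p j)) := by
  refine ⟨fun h => ?_, ?_⟩
  · obtain ⟨F, hF, hFx⟩ := exists_contDiff_comp_eq (G := G) (p := p)
      (fun q hq => hgen q fun γ hγ x => hq ⟨γ, hγ⟩ x) f.2 (fun γ x => h γ γ.2 x)
    exact ⟨⟨F, hF⟩, hFx⟩
  · rintro ⟨F, hF⟩ γ hγ x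
    rw [hF, hF]
    simp only [hinv _ γ hγ]
end
end
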